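/- arXiv:2305.05742 — 6 statements merged into one kernel-verified Lean document; each statement's English description precedes it below -/
import Mathlib

section
/- Let T = [v_0,…,v_d] (in Maubach's vertex ordering) with k := d − (gen(T) mod d) result from successive Maubach bisections of an initial simplex whose vertex colors read (d,0,1,…,d−1). Then: (1) if k = d, then level(v_0) < level(v_1) = … = level(v_d), gen(v_0) < gen(v_1), and gen(v_j) = level(T)·d + 1 − j for j = 1,…,d; (2) if 1 ≤ k < d and level(v_0) < level(v_1), then level(v_1) = … = level(v_k), level(v_{k+1}) = … = level(v_d) = level(v_k)+1, gen(v_0) < gen(v_1), gen(v_j) = level(T)·d + 1 − d − j for j = 1,…,k, and gen(v_j) = level(T)·d + 1 − j for j = k+1,…,d; (3) if 1 ≤ k < d and level(v_0) = level(v_1), then level(v_0) = … = level(v_k), level(v_{k+1}) = … = level(v_d) = level(v_k)+1, gen(v_{k+1}) = gen(v_k) + 2d − type(v_0), gen(v_j) = gen(v_{j+1}) + 1 for j = 0,…,k−1, and gen(v_j) = level(T)·d + 1 − j for j = k+1,…,d. -/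
noncomputable section

namespace BisecGrading

/-- Points of `ℝ^d`. -/
abbrev Pt (d : ℕ) : Type := Fin d → ℝ

/-- Integer ceiling `⌈g / d⌉` (for `d > 0`). -/
def lvlZ (d : ℕ) (g : ℤ) : ℤ := (g + d - 1) / d

/-- The type `g - d * (⌈g/d⌉ - 1)` of a generation `g`. -/
def typZ (d : ℕ) (g : ℤ) : ℤ := g - d * (lvlZ d g - 1)

/-- A `d`-simplex, given by its ordered vertex list (in Maubach's ordering) together
with its generation counter. -/
structure Simplex (d : ℕ) where
  vertex : Fin (d + 1) → Pt d
  gen : ℕ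

namespace Simplex

variable {d : ℕ}

instance : DecidableEq (Simplex d) := Classical.decEq _

/-- Maubach's index `k = d - (gen T % d)`. -/
def k (T : Simplex d) : ℕ := d - T.gen % d

lemma k_le (T : Simplex d) : T.k ≤ d := Nat.sub_le _ _

/-- `k` as an index into the vertex list. -/
def kIdx (T : Simplex d) : Fin (d + 1) := ⟨T.k, Nat.lt_succ_of_le T.k_le⟩

/-- The bisection vertex `(v₀ + v_k)/2`. -/
def bsv (T : Simplex d) : Pt d := midpoint ℝ (T.vertex 0) (T.vertex T.kIdx)

/-- The bisection edge `[v₀, v_k]`, as an unordered pair of points. -/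
def bse (T : Simplex d) : Sym2 (Pt d) := s(T.vertex 0, T.vertex T.kIdx)

/-- The first child `[v₀, …, v_{k-1}, v', v_{k+1}, …, v_d]` of Maubach's bisection. -/
def child1 (T : Simplex d) : Simplex d where
  vertex := Function.update T.vertex T.kIdx T.bsv
  gen := T.gen + 1

/-- The second child `[v₁, …, v_k, v', v_{k+1}, …, v_d]` of Maubach's bisection. -/
def child2 (T : Simplex d) : Simplex d where
  vertex := fun i =>
    if h : (i : ℕ) < T.k then
      T.vertex ⟨(i : ℕ) + 1, by have hk := T.k_le; omega⟩
    else if (i : ℕ) = T.k then T.bsv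
    else T.vertex i
  gen := T.gen + 1

/-- `T'` is a child of `T`. -/
def IsChild (T' T : Simplex d) : Prop := T' = T.child1 ∨ T' = T.child2

/-- The vertex set `𝒱(T)`. -/
def V (T : Simplex d) : Set (Pt d) := Set.range T.vertex

/-- The edge set `ℰ(T)`. -/
def E (T : Simplex d) : Set (Sym2 (Pt d)) :=
  {e | ∃ i j : Fin (d + 1), i ≠ j ∧ e = s(T.vertex i, T.vertex j)}

/-- The closed simplex (convex hull of the vertices). -/
def hull (T : Simplex d) : Set (Pt d) := convexHull ℝ (Set.range T.vertex)

/-- The level `⌈gen/d⌉` of a `d`-simplex. -/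
def lvl (T : Simplex d) : ℤ := lvlZ d T.gen

/-- The type of a `d`-simplex. -/
def typ (T : Simplex d) : ℤ := typZ d T.gen

end Simplex

variable {d : ℕ}

/-- Membership in the master tree generated from the initial triangulation `T0`. -/
inductive MemM (T0 : Finset (Simplex d)) : Simplex d → Prop
  | init {T : Simplex d} : T ∈ T0 → MemM T0 T
  | child {T T' : Simplex d} : MemM T0 T → T'.IsChild T → MemM T0 T'

/-- `Refines 𝒯₁ 𝒯₂` : the partition `𝒯₂` is obtained from `𝒯₁` by finitely many
single bisections. -/
inductive Refines : Finset (Simplex d) → Finset (Simplex d) → Prop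
  | refl (𝒯 : Finset (Simplex d)) : Refines 𝒯 𝒯
  | step {𝒯₁ 𝒯₂ : Finset (Simplex d)} (T : Simplex d) :
      Refines 𝒯₁ 𝒯₂ → T ∈ 𝒯₂ →
      Refines 𝒯₁ (insert T.child1 (insert T.child2 (𝒯₂.erase T)))

/-- The subsimplex of `T` spanned by the vertex positions in `s`. -/
def faceSet (T : Simplex d) (s : Finset (Fin (d + 1))) : Set (Pt d) :=
  convexHull ℝ (T.vertex '' ↑s)

/-- Conformity: any two simplices meet in the empty set or in a common subsimplex. -/
def Conforming (𝒯 : Finset (Simplex d)) : Prop :=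
  ∀ T₁ ∈ 𝒯, ∀ T₂ ∈ 𝒯,
    T₁.hull ∩ T₂.hull = ∅ ∨
      ∃ s₁ s₂ : Finset (Fin (d + 1)), s₁.Nonempty ∧ s₂.Nonempty ∧
        T₁.hull ∩ T₂.hull = faceSet T₁ s₁ ∧ T₁.hull ∩ T₂.hull = faceSet T₂ s₂

/-- The conforming triangulations obtained from `T0` by successive bisections. -/
def Bisec (T0 : Finset (Simplex d)) : Set (Finset (Simplex d)) :=
  {𝒯 | Refines T0 𝒯 ∧ Conforming 𝒯}

/-- All vertices of a triangulation. -/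
def verticesOf (𝒯 : Finset (Simplex d)) : Set (Pt d) := ⋃ T ∈ 𝒯, T.V

/-- All edges of a triangulation. -/
def edgesOf (𝒯 : Finset (Simplex d)) : Set (Sym2 (Pt d)) := ⋃ T ∈ 𝒯, T.E

/-- Midpoint of an edge; this is the bisection vertex of the edge. -/
def edgeMid (e : Sym2 (Pt d)) : Pt d :=
  Sym2.lift ⟨fun a b => midpoint ℝ a b, fun a b => midpoint_comm a b⟩ e

/-- The closed segment covered by an edge. -/
def edgeSeg (e : Sym2 (Pt d)) : Set (Pt d) :=
  Sym2.lift ⟨fun a b => segment ℝ a b, fun a b => segment_symm ℝ a b⟩ e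

/-- A colored conforming initial triangulation (with the vertices of each initial
simplex ordered so that the colors read `(d, 0, 1, …, d-1)`), together with the
induced generation function on all vertices of the master tree. -/
structure ColoredSetup (d : ℕ) where
  T0 : Finset (Simplex d)
  indep : ∀ T ∈ T0, AffineIndependent ℝ T.vertex
  gen_zero : ∀ T ∈ T0, T.gen = 0
  conf : Conforming T0
  disjInt : ∀ T₁ ∈ T0, ∀ T₂ ∈ T0, T₁ ≠ T₂ → interior T₁.hull ∩ interior T₂.hull = ∅
  color : Pt d → ℕ
  color_zero : ∀ T ∈ T0, color (T.vertex 0) = d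
  color_succ : ∀ T ∈ T0, ∀ i : Fin (d + 1), (i : ℕ) ≠ 0 → color (T.vertex i) = (i : ℕ) - 1
  vgen : Pt d → ℤ
  vgen_init : ∀ T ∈ T0, ∀ i : Fin (d + 1), vgen (T.vertex i) = -(color (T.vertex i) : ℤ)
  vgen_bsv : ∀ T : Simplex d, MemM T0 T → vgen T.bsv = (T.gen : ℤ) + 1

namespace ColoredSetup

variable {d : ℕ} (S : ColoredSetup d)

/-- Level of a vertex. -/
def lvlV (v : Pt d) : ℤ := lvlZ d (S.vgen v)

/-- Type of a vertex. -/
def typV (v : Pt d) : ℤ := typZ d (S.vgen v)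

/-- Generation of an edge: the maximal generation of its endpoints. -/
def genE (e : Sym2 (Pt d)) : ℤ :=
  Sym2.lift ⟨fun a b => max (S.vgen a) (S.vgen b), fun a b => max_comm _ _⟩ e

/-- Level of an edge. -/
def lvlE (e : Sym2 (Pt d)) : ℤ := lvlZ d (S.genE e)

/-- Type of an edge. -/
def typE (e : Sym2 (Pt d)) : ℤ := typZ d (S.genE e)

/-- `gen#` of an edge: the generation of its bisection vertex (= its midpoint). -/
def genSharpE (e : Sym2 (Pt d)) : ℤ := S.vgen (edgeMid e)

/-- `level#` of an edge. -/
def lvlSharpE (e : Sym2 (Pt d)) : ℤ := lvlZ d (S.genSharpE e)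

/-- `type#` of an edge. -/
def typSharpE (e : Sym2 (Pt d)) : ℤ := typZ d (S.genSharpE e)

end ColoredSetup

/-- Chains of pairwise intersecting simplices of length `N`. -/
def IsSimChain (𝒮 : Set (Simplex d)) (T T' : Simplex d) (N : ℕ) : Prop :=
  ∃ f : Fin (N + 1) → Simplex d, (∀ i, f i ∈ 𝒮) ∧ f 0 = T ∧ f (Fin.last N) = T' ∧
    ∀ i : Fin N, ((f i.castSucc).hull ∩ (f i.succ).hull).Nonempty

/-- The simplex distance `δ_𝒯`. -/
def simDist (𝒯 : Finset (Simplex d)) (T T' : Simplex d) : ℕ :=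
  sInf {N | IsSimChain (↑𝒯) T T' N}

/-- Chains of `1`-neighbours (consecutive simplices share an edge). -/
def Is1Chain (𝒮 : Set (Simplex d)) (T T' : Simplex d) (N : ℕ) : Prop :=
  ∃ f : Fin (N + 1) → Simplex d, (∀ i, f i ∈ 𝒮) ∧ f 0 = T ∧ f (Fin.last N) = T' ∧
    ∀ i : Fin N, ((f i.castSucc).E ∩ (f i.succ).E).Nonempty

/-- The `1`-distance `δ¹_𝒮`. -/
def dist1 (𝒮 : Set (Simplex d)) (T T' : Simplex d) : ℕ :=
  sInf {N | Is1Chain 𝒮 T T' N}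

/-- The uniform patch `ω_{𝒯₀⁺}(v)` in the full uniform refinement `𝒯₀⁺`. -/
def patchPlus (S : ColoredSetup d) (v : Pt d) : Set (Simplex d) :=
  {T | MemM S.T0 T ∧ T.gen = d ∧ v ∈ T.V}

/-- The constant `C(𝒯₀)`. -/
def Cconst (S : ColoredSetup d) : ℕ :=
  sSup {n | ∃ v ∈ verticesOf S.T0, ∃ T ∈ patchPlus S v, ∃ T' ∈ patchPlus S v,
    n = dist1 (patchPlus S v) T T'}

/-- `v` lies in some `n`-subsimplex of an initial simplex. -/
def InMacroSub (S : ColoredSetup d) (n : ℕ) (v : Pt d) : Prop :=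
  ∃ T ∈ S.T0, ∃ s : Finset (Fin (d + 1)), s.card = n + 1 ∧ v ∈ convexHull ℝ (T.vertex '' ↑s)

/-- `v` is an `n`-macro vertex. -/
def IsMacro (S : ColoredSetup d) (n : ℕ) (v : Pt d) : Prop :=
  InMacroSub S n v ∧ ∀ m : ℕ, m < n → ¬ InMacroSub S m v

/-- The maximal level jump at a vertex `v`. -/
def jump (S : ColoredSetup d) (v : Pt d) : ℕ :=
  sSup {n | ∃ 𝒯 ∈ Bisec S.T0, ∃ e ∈ edgesOf 𝒯, ∃ e' ∈ edgesOf 𝒯,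
    v ∈ e ∧ v ∈ e' ∧ (n : ℤ) = |S.lvlE e - S.lvlE e'|}

/-- The constants `J_n`. -/
def J (S : ColoredSetup d) (n : ℕ) : ℤ :=
  if n = 0 then ⌈((Cconst S : ℚ) + 1) * (1 - 1 / (d : ℚ))⌉ - 2
  else if n ≤ d - 2 then 2 else 0

/-- The constant `Γ = 1 + Σ_{n=0}^{d-2} J_n`. -/
def Gam (S : ColoredSetup d) : ℤ := 1 + ∑ n ∈ Finset.range (d - 1), J S n

/-- The edges spanned by a set of points. -/
def edgeOfSet (A : Set (Pt d)) : Set (Sym2 (Pt d)) :=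
  {e | ∃ a ∈ A, ∃ b ∈ A, a ≠ b ∧ e = s(a, b)}

/-- `FirstBisected A T e` : along descendants of `T` that keep all points of `A` as
vertices, `e` is the first edge spanned by points of `A` which occurs as a bisection
edge, i.e. the edge of the subsimplex spanned by `A` that is bisected first. -/
inductive FirstBisected (A : Set (Pt d)) : Simplex d → Sym2 (Pt d) → Prop
  | found {T : Simplex d} : T.bse ∈ edgeOfSet A → FirstBisected A T T.bse
  | step {T T' : Simplex d} {e : Sym2 (Pt d)} :
      T.bse ∉ edgeOfSet A → T'.IsChild T → A ⊆ T'.V →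
      FirstBisected A T' e → FirstBisected A T e

/-- The uniform vertex patch `ω_m(v)`. -/
def patchU (S : ColoredSetup d) (m : ℕ) (v : Pt d) : Set (Simplex d) :=
  {T | MemM S.T0 T ∧ T.gen = m * d ∧ v ∈ T.V}

/-- The patch boundary `∂ω_m(v)`: union of the `(d-1)`-subsimplices of members of
`ω_m(v)` not containing `v`. -/
def patchBd (S : ColoredSetup d) (m : ℕ) (v : Pt d) : Set (Pt d) :=
  ⋃ T ∈ patchU S m v,
    ⋃ s ∈ {s : Finset (Fin (d + 1)) | s.card = d ∧ v ∉ convexHull ℝ (T.vertex '' ↑s)},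
      convexHull ℝ (T.vertex '' ↑s)

/-- The neighbourhood `Ω_m(v)`. -/
def nbhd (S : ColoredSetup d) (m : ℕ) (v : Pt d) : Set (Pt d) :=
  (⋃ T ∈ patchU S m v, T.hull) \ patchBd S m v

/-- The Kuhn simplex `T_π = [0, e_{π(1)}, e_{π(1)}+e_{π(2)}, …]`, of generation `0`. -/
def kuhnSimplex (d : ℕ) (π : Equiv.Perm (Fin d)) : Simplex d where
  vertex := fun i x => if ((π.symm x : ℕ)) < (i : ℕ) then 1 else 0
  gen := 0

/-- The average diameter `h₀` of the initial triangulation. -/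
def avgDiam (T0 : Finset (Simplex d)) : ℝ :=
  (∑ T ∈ T0, Metric.diam T.hull) / T0.card

/-- The regularized mesh size function `h_𝒯`. -/
def regMesh (T0 𝒯 : Finset (Simplex d)) (T : Simplex d) : ℝ :=
  avgDiam T0 * sInf {x : ℝ | ∃ T' ∈ 𝒯, x = (2 : ℝ) ^ (-(T'.lvl) + (simDist 𝒯 T T' : ℤ))}

/-- The generations of the vertices `v₀, …, v_d` of a simplex of generation `q * d + (d - k)`
with `1 ≤ k ≤ d`: the tail `v_{k+1}, …, v_d` carries the newest generations, while
`v₁, …, v_k` either all stem from the previous level or continue a run starting in `v₀`. -/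
def SortedGens (d q k : ℕ) (g : ℕ → ℤ) : Prop :=
  (∀ j, k < j → j ≤ d → g j = q * d + d + 1 - j) ∧
  ((g 0 ≤ q * d - d ∧ ∀ j, 1 ≤ j → j ≤ k → g j = q * d + 1 - j) ∨
    (k < d ∧ g 0 ≤ q * d ∧ q * d - d + 1 ≤ g 0 - k ∧ ∀ j, j ≤ k → g j = g 0 - j))

/-- Bisecting a simplex with sorted vertex generations, where `k ≥ 2`, keeps them sorted. -/
lemma SortedGens.bisect {d q k : ℕ} {g h : ℕ → ℤ} (hk : 2 ≤ k) (hkd : k ≤ d)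
    (hg : SortedGens d q k g) (hmid : h k = q * d + d + 1 - k)
    (htail : ∀ j, k < j → j ≤ d → h j = g j)
    (hinit : (∀ j, j < k → h j = g j) ∨ (∀ j, j < k → h j = g (j + 1))) :
    SortedGens d q (k - 1) h := by
  obtain ⟨hA, hB⟩ := hg
  unfold SortedGens
  generalize (q : ℤ) * d = D at *
  refine ⟨fun j h1 h2 => ?_, ?_⟩
  · obtain rfl | h3 := (show k ≤ j by omega).eq_or_lt
    · exact hmid
    · rw [htail j h3 h2, hA j h3 h2]
  · rcases hinit with hi | hi
    · have h0 := hi 0 (by omega)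
      rcases hB with ⟨hb, hB⟩ | ⟨hk', hb, hc, hB⟩
      · refine Or.inl ⟨by omega, fun j h1 h2 => ?_⟩
        rw [hi j (by omega), hB j h1 (by omega)]
      · refine Or.inr ⟨by omega, by omega, by omega, fun j h1 => ?_⟩
        rw [hi j (by omega), hB j (by omega), h0]
    · have h0 := hi 0 (by omega)
      rcases hB with ⟨hb, hB⟩ | ⟨hk', hb, hc, hB⟩
      · have h1 := hB 1 (by omega) (by omega)
        refine Or.inr ⟨by omega, by simp at *; omega, by simp at *; omega, fun j h2 => ?_⟩
        have h3 := hi j (by omega)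
        have h4 := hB (j + 1) (by omega) (by omega)
        simp at *
        omega
      · have h1 := hB 1 (by omega)
        refine Or.inr ⟨by omega, by simp at *; omega, by simp at *; omega, fun j h2 => ?_⟩
        have h3 := hi j (by omega)
        have h4 := hB (j + 1) (by omega)
        simp at *
        omega

/-- Bisecting a simplex with sorted vertex generations, where `k = 1`, starts a new cycle. -/
lemma SortedGens.bisect_one {d q : ℕ} {g h : ℕ → ℤ}
    (hg : SortedGens d q 1 g) (hmid : h 1 = q * d + d)
    (htail : ∀ j, 1 < j → j ≤ d → h j = g j) (hinit : h 0 = g 0 ∨ h 0 = g 1) :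
    SortedGens d (q + 1) d h := by
  obtain ⟨hA, hB⟩ := hg
  unfold SortedGens
  push_cast
  rw [add_mul, one_mul]
  generalize (q : ℤ) * d = D at *
  refine ⟨fun j h1 h2 => by omega, Or.inl ⟨?_, fun j h1 h2 => ?_⟩⟩
  · rcases hB with ⟨hb, hB⟩ | ⟨hk', hb, hc, hB⟩
    · have h1 := hB 1 le_rfl le_rfl
      push_cast at h1
      omega
    · have h1 := hB 1 le_rfl
      push_cast at h1
      omega
  · obtain rfl | h3 := h1.eq_or_lt
    · push_cast
      omega
    · rw [htail j h3 h2, hA j h3 h2]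

/-- The vertex generations of `T`, indexed by natural numbers (and `0` beyond `d`). -/
def ColoredSetup.vertexGen {d : ℕ} (S : ColoredSetup d) (T : Simplex d) (j : ℕ) : ℤ :=
  if h : j < d + 1 then S.vgen (T.vertex ⟨j, h⟩) else 0

lemma ColoredSetup.vertexGen_coe {d : ℕ} (S : ColoredSetup d) (T : Simplex d) (j : Fin (d + 1)) :
    S.vertexGen T j = S.vgen (T.vertex j) := by
  exact dif_pos j.is_lt

lemma ColoredSetup.vertexGen_child1 {d : ℕ} (S : ColoredSetup d) (T : Simplex d) {j : ℕ}
    (hj : j ≠ T.k) : S.vertexGen T.child1 j = S.vertexGen T j := by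
  have : ∀ h : j < d + 1, (⟨j, h⟩ : Fin (d + 1)) ≠ T.kIdx := fun h he =>
    hj (congrArg Fin.val he)
  simp only [ColoredSetup.vertexGen, Simplex.child1]
  split_ifs with h
  · rw [Function.update_of_ne (this h)]
  · rfl

lemma ColoredSetup.vertexGen_child1_k {d : ℕ} (S : ColoredSetup d) (T : Simplex d) :
    S.vertexGen T.child1 T.k = S.vgen T.bsv := by
  rw [show T.k = (T.kIdx : ℕ) from rfl, S.vertexGen_coe]
  simp [Simplex.child1]

lemma ColoredSetup.vertexGen_child2_lt {d : ℕ} (S : ColoredSetup d) (T : Simplex d) {j : ℕ}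
    (hj : j < T.k) : S.vertexGen T.child2 j = S.vertexGen T (j + 1) := by
  have hk := T.k_le
  simp only [ColoredSetup.vertexGen, Simplex.child2]
  rw [dif_pos (by omega), dif_pos hj, dif_pos (by omega)]

lemma ColoredSetup.vertexGen_child2_k {d : ℕ} (S : ColoredSetup d) (T : Simplex d) :
    S.vertexGen T.child2 T.k = S.vgen T.bsv := by
  rw [show T.k = (T.kIdx : ℕ) from rfl, S.vertexGen_coe]
  simp [Simplex.child2, Simplex.kIdx]

lemma ColoredSetup.vertexGen_child2_gt {d : ℕ} (S : ColoredSetup d) (T : Simplex d) {j : ℕ}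
    (hj : T.k < j) : S.vertexGen T.child2 j = S.vertexGen T j := by
  simp only [ColoredSetup.vertexGen, Simplex.child2]
  split_ifs <;> first | rfl | omega

lemma Simplex.k_eq {d : ℕ} {T : Simplex d} {q k : ℕ} (hk : 1 ≤ k) (hkd : k ≤ d)
    (h : T.gen = q * d + (d - k)) : T.k = k := by
  rw [Simplex.k, h, mul_comm, Nat.mul_add_mod, Nat.mod_eq_of_lt (by omega)]
  omega

/-- Every simplex of the master tree has sorted vertex generations. -/
lemma MemM.exists_sortedGens {d : ℕ} (hd : 1 ≤ d) (S : ColoredSetup d) {T : Simplex d}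
    (hT : MemM S.T0 T) :
    ∃ q k : ℕ, 1 ≤ k ∧ k ≤ d ∧ T.gen = q * d + (d - k) ∧ SortedGens d q k (S.vertexGen T) := by
  induction hT with
  | @init T hT =>
    refine ⟨0, d, hd, le_rfl, by simp [S.gen_zero T hT], fun j h1 h2 => by omega,
      Or.inl ⟨?_, fun j h1 h2 => ?_⟩⟩
    · have := S.vertexGen_coe T 0
      rw [S.vgen_init T hT, S.color_zero T hT] at this
      simp at *
      omega
    · have := S.vertexGen_coe T ⟨j, by omega⟩
      rw [S.vgen_init T hT, S.color_succ T hT _ (by simp; omega)] at this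
      simp only [CharP.cast_eq_zero, zero_mul] at *
      omega
  | @child T T' hT hc ih =>
    obtain ⟨q, k, hk1, hkd, hgen, hs⟩ := ih
    have hk := Simplex.k_eq hk1 hkd hgen
    have hb : S.vgen T.bsv = q * d + d + 1 - k := by
      rw [S.vgen_bsv T hT, hgen]
      push_cast [hkd]
      ring
    have hgen' : T'.gen = q * d + (d - k) + 1 := by
      rcases hc with rfl | rfl <;> simp [Simplex.child1, Simplex.child2, hgen]
    have hmid : S.vertexGen T' k = q * d + d + 1 - k := by
      rw [← hb, ← hk]
      rcases hc with rfl | rfl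
      exacts [S.vertexGen_child1_k T, S.vertexGen_child2_k T]
    have htail : ∀ j, k < j → j ≤ d → S.vertexGen T' j = S.vertexGen T j := by
      intro j h1 _
      rcases hc with rfl | rfl
      exacts [S.vertexGen_child1 T (by omega), S.vertexGen_child2_gt T (by omega)]
    have hinit : (∀ j, j < k → S.vertexGen T' j = S.vertexGen T j) ∨
        (∀ j, j < k → S.vertexGen T' j = S.vertexGen T (j + 1)) := by
      rcases hc with rfl | rfl
      · exact Or.inl fun j hj => S.vertexGen_child1 T (by omega)
      · exact Or.inr fun j hj => S.vertexGen_child2_lt T (by omega)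
    obtain rfl | hk2 := hk1.eq_or_lt
    · refine ⟨q + 1, d, hd, le_rfl, ?_, hs.bisect_one (by rw [hmid]; push_cast; ring) htail
        (hinit.imp (fun h => h 0 one_pos) (fun h => h 0 one_pos))⟩
      rw [hgen', add_mul]
      omega
    · exact ⟨q, k - 1, by omega, by omega, by omega, hs.bisect hk2 hkd hmid htail hinit⟩

/-- The level `⌈g / d⌉` is the unique `L` with `(L - 1) d < g ≤ L d`. -/
lemma lvlZ_eq {d : ℕ} {g L : ℤ} (h1 : L * d - d < g) (h2 : g ≤ L * d) : lvlZ d g = L := by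
  unfold lvlZ
  have hd : (0 : ℤ) < d := by omega
  apply le_antisymm
  · apply Int.lt_add_one_iff.1
    rw [Int.ediv_lt_iff_lt_mul hd]
    linarith
  · rw [Int.le_ediv_iff_mul_le hd]
    linarith

lemma lvlZ_mono {d : ℕ} {g L : ℤ} (hd : 1 ≤ d) (h : g ≤ L * d) : lvlZ d g ≤ L := by
  unfold lvlZ
  apply Int.lt_add_one_iff.1
  rw [Int.ediv_lt_iff_lt_mul (by omega)]
  linarith

theorem maubach_sorting_structure (d : ℕ) (hd : 2 ≤ d) (S : ColoredSetup d)
    (T : Simplex d) (hT : MemM S.T0 T) :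
    (T.k = d →
      S.lvlV (T.vertex 0) < S.lvlV (T.vertex ⟨1, by omega⟩) ∧
      (∀ j : Fin (d + 1), 1 ≤ (j : ℕ) →
        S.lvlV (T.vertex j) = S.lvlV (T.vertex ⟨1, by omega⟩)) ∧
      S.vgen (T.vertex 0) < S.vgen (T.vertex ⟨1, by omega⟩) ∧
      (∀ j : Fin (d + 1), 1 ≤ (j : ℕ) →
        S.vgen (T.vertex j) = T.lvl * d + 1 - (j : ℕ))) ∧
    (1 ≤ T.k → T.k < d → S.lvlV (T.vertex 0) < S.lvlV (T.vertex ⟨1, by omega⟩) →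
      (∀ j : Fin (d + 1), 1 ≤ (j : ℕ) → (j : ℕ) ≤ T.k →
        S.lvlV (T.vertex j) = S.lvlV (T.vertex ⟨1, by omega⟩)) ∧
      (∀ j : Fin (d + 1), T.k < (j : ℕ) →
        S.lvlV (T.vertex j) = S.lvlV (T.vertex T.kIdx) + 1) ∧
      S.vgen (T.vertex 0) < S.vgen (T.vertex ⟨1, by omega⟩) ∧
      (∀ j : Fin (d + 1), 1 ≤ (j : ℕ) → (j : ℕ) ≤ T.k →
        S.vgen (T.vertex j) = T.lvl * d + 1 - d - (j : ℕ)) ∧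
      (∀ j : Fin (d + 1), T.k < (j : ℕ) →
        S.vgen (T.vertex j) = T.lvl * d + 1 - (j : ℕ))) ∧
    (1 ≤ T.k → T.k < d → S.lvlV (T.vertex 0) = S.lvlV (T.vertex ⟨1, by omega⟩) →
      (∀ j : Fin (d + 1), (j : ℕ) ≤ T.k → S.lvlV (T.vertex j) = S.lvlV (T.vertex 0)) ∧
      (∀ j : Fin (d + 1), T.k < (j : ℕ) →
        S.lvlV (T.vertex j) = S.lvlV (T.vertex T.kIdx) + 1) ∧
      (∀ j : Fin (d + 1), (j : ℕ) = T.k + 1 →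
        S.vgen (T.vertex j) = S.vgen (T.vertex T.kIdx) + 2 * d - S.typV (T.vertex 0)) ∧
      (∀ j j' : Fin (d + 1), (j' : ℕ) = (j : ℕ) + 1 → (j : ℕ) < T.k →
        S.vgen (T.vertex j) = S.vgen (T.vertex j') + 1) ∧
      (∀ j : Fin (d + 1), T.k < (j : ℕ) →
        S.vgen (T.vertex j) = T.lvl * d + 1 - (j : ℕ))) := by
  obtain ⟨q, k, hk1, hkd, hgen, hA, hB⟩ := hT.exists_sortedGens (by omega) S
  have hk := Simplex.k_eq hk1 hkd hgen
  have hv : ∀ j : Fin (d + 1), S.vertexGen T j = S.vgen (T.vertex j) := S.vertexGen_coe T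
  have h0 := hv 0
  have h1 := hv ⟨1, by omega⟩
  have hvk : S.vertexGen T k = S.vgen (T.vertex T.kIdx) := by
    rw [← hv, ← hk, Simplex.kIdx]
  simp only [Fin.val_zero] at h0 h1
  have hlow {g : ℤ} (h1 : q * d - d < g) (h2 : g ≤ q * d) : lvlZ d g = q := lvlZ_eq h1 h2
  have hhigh {g : ℤ} (h1 : q * d < g) (h2 : g ≤ q * d + d) : lvlZ d g = q + 1 :=
    lvlZ_eq (by linarith) (by linarith)
  have hless {g : ℤ} (h : g ≤ q * d - d) : lvlZ d g ≤ q - 1 :=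
    lvlZ_mono (by omega) (by linarith)
  have hgenZ : (T.gen : ℤ) = q * d + (d - k) := by rw [hgen]; push_cast [hkd]; ring
  have hTd : k = d → T.lvl * d = q * d := by
    intro h
    rw [Simplex.lvl, hlow (by omega) (by omega)]
  have hTlt : k < d → T.lvl * d = q * d + d := by
    intro h
    rw [Simplex.lvl, hhigh (by omega) (by omega), add_mul, one_mul]
  have htyp {g : ℤ} (h1 : q * d - d < g) (h2 : g ≤ q * d) : typZ d g = g - q * d + d := by
    rw [typZ, hlow h1 h2]; ring
  rw [hk]
  simp only [ColoredSetup.lvlV, ColoredSetup.typV, ← hvk, ← h0, ← h1]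
  simp only [← hv]
  generalize S.vertexGen T = g at *
  generalize (q : ℤ) * d = D at *
  have htail : k < d → ∀ j : Fin (d + 1), k < j → g j = T.lvl * d + 1 - (j : ℕ) := by
    intro h j hj
    rw [hTlt h, hA j hj (by omega)]
  have htailLvl : ∀ j : Fin (d + 1), k < j → lvlZ d (g j) = q + 1 := by
    intro j hj
    have := hA j hj (by omega)
    exact hhigh (by omega) (by omega)
  rcases hB with ⟨hb, hB⟩ | ⟨hk', hb, hc, hB⟩
  · have hl : ∀ j : ℕ, 1 ≤ j → j ≤ k → lvlZ d (g j) = q := by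
      intro j h1 h2
      have := hB j h1 h2
      exact hlow (by omega) (by omega)
    have hl0 := hless hb
    have hl1 := hl 1 le_rfl hk1
    have hlk := hl k hk1 le_rfl
    have hg1 := hB 1 le_rfl hk1
    push_cast at hg1
    refine ⟨fun h => ⟨by omega, fun j hj => ?_, by omega, fun j hj => ?_⟩,
      fun _ h _ => ⟨fun j hj hj' => ?_, fun j hj => ?_, by omega, fun j hj hj' => ?_, htail h⟩,
      fun _ _ h => by omega⟩
    · rw [hl1, hl j hj (by omega)]
    · rw [hTd h, hB j hj (by omega)]
    · rw [hl1, hl j hj (by omega)]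
    · rw [hlk, htailLvl j hj]
    · rw [hTlt h, hB j hj (by omega)]
      ring
  · have hl : ∀ j : ℕ, j ≤ k → lvlZ d (g j) = q := by
      intro j h1
      have := hB j h1
      exact hlow (by omega) (by omega)
    have hl0 := hl 0 (by omega)
    have hl1 := hl 1 hk1
    have hlk := hl k le_rfl
    have hgk := hB k le_rfl
    refine ⟨fun h => by omega, fun _ _ h => by omega,
      fun _ _ _ => ⟨fun j hj => ?_, fun j hj => ?_, fun j hj => ?_, fun j j' hj hj' => ?_,
        htail hk'⟩⟩
    · rw [hl0, hl j hj]
    · rw [hlk, htailLvl j hj]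
    · rw [htyp (by omega) hb, hA j (by omega) (by omega), hgk, hj]
      push_cast
      ring
    · rw [hB j (by omega), hB j' (by omega), hj]
      push_cast
      ring

end BisecGrading
end
end

section
/- Let 𝒯_0 be a colored initial triangulation and let T = ⟨v_0,…,v_d⟩ ∈ 𝕄 be a d-simplex of the master tree with its vertices sorted by decreasing generation, with bisection edge bse(T). Then: (1) if level(v_{d−1}) ≠ level(v_d), then head(T) = ⟨v_0,…,v_{d−1}⟩, tail(T) = ⟨v_d⟩, and bse(T) = [v_{d−1}, v_d]; (2) if level(v_{d−1}) = level(v_d), then type(v_0) < d, head(T) = ⟨v_0,…,v_{type(v_0)−1}⟩, tail(T) = ⟨v_{type(v_0)},…,v_d⟩, and bse(T) = [v_{type(v_0)}, v_d]. -/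
noncomputable section

namespace BisecGrading

variable {d : ℕ}

/-- The level is `q` on the generations `(q - 1) d + 1, …, q d`. -/
lemma lvlZ_eq_s3 (d : ℕ) {g q : ℤ} (h₁ : d * q - d < g) (h₂ : g ≤ d * q) : lvlZ d g = q := by
  unfold lvlZ
  rw [Int.ediv_eq_iff_of_pos (by omega)]
  constructor <;> linarith

lemma lvlZ_lt (d : ℕ) (hd : 0 < d) {g q : ℤ} (h : g ≤ d * q - d) : lvlZ d g < q := by
  unfold lvlZ
  apply Int.ediv_lt_of_lt_mul (by omega)
  linarith

/-- The vertex generations along the list of vertices in Maubach's ordering, for a simplex of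
generation `d * q + r`. The first `d - r + 1` vertices are consecutive vertices, starting from
position `s`, of an ancestor of generation `d * q`. -/
structure GenPattern (S : ColoredSetup d) (T : Simplex d) (q r s : ℕ) : Prop where
  gen_eq : T.gen = d * q + r
  r_lt : r < d
  s_le : s ≤ r
  new : ∀ i : Fin (d + 1), d - r < (i : ℕ) → S.vgen (T.vertex i) = d * q + d - (i : ℕ) + 1
  old : ∀ i : Fin (d + 1), (i : ℕ) ≤ d - r → 0 < s + i →
    S.vgen (T.vertex i) = d * q - (s + (i : ℕ)) + 1
  first : s = 0 → S.vgen (T.vertex 0) ≤ d * q - d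

lemma GenPattern.k_eq {S : ColoredSetup d} {T : Simplex d} {q r s : ℕ}
    (h : GenPattern S T q r s) : T.k = d - r := by
  rw [Simplex.k, h.gen_eq, Nat.mul_add_mod, Nat.mod_eq_of_lt h.r_lt]

lemma GenPattern.vgen_le {S : ColoredSetup d} {T : Simplex d} {q r s : ℕ}
    (h : GenPattern S T q r s) (i : Fin (d + 1)) (hi : (i : ℕ) ≤ d - r) :
    S.vgen (T.vertex i) ≤ d * q := by
  by_cases hs : 0 < s + i
  · rw [h.old i hi hs]
    omega
  · have hi0 : i = 0 := Fin.ext (by rw [Fin.val_zero]; omega)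
    have := h.first (by omega)
    rw [hi0]
    omega

lemma exists_genPattern (hd : 0 < d) (S : ColoredSetup d) {T : Simplex d} (hT : MemM S.T0 T) :
    ∃ q r s, GenPattern S T q r s := by
  induction hT with
  | init hT =>
    refine ⟨0, 0, 0, by simpa using S.gen_zero _ hT, hd, le_rfl, ?_, ?_, ?_⟩
    · intro i hi
      omega
    · intro i _ hi
      rw [S.vgen_init _ hT, S.color_succ _ hT i (by omega)]
      push_cast
      omega
    · intro _
      rw [S.vgen_init _ hT, S.color_zero _ hT]
      simp
  | @child T T' hT hc ih =>
    obtain ⟨q, r, s, h⟩ := ih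
    have hk := h.k_eq
    have hr := h.r_lt
    have hb : S.vgen T.bsv = d * q + r + 1 := by
      rw [S.vgen_bsv T hT, h.gen_eq]
      push_cast
      ring
    have hgen : T'.gen = d * q + r + 1 := by
      rcases hc with rfl | rfl
      · exact congrArg (· + 1) h.gen_eq
      · exact congrArg (· + 1) h.gen_eq
    have hnew : ∀ i : Fin (d + 1), d - (r + 1) < (i : ℕ) →
        S.vgen (T'.vertex i) = d * q + d - (i : ℕ) + 1 := by
      intro i hi
      by_cases hik : (i : ℕ) = d - r
      · have hv : T'.vertex i = T.bsv := by
          rcases hc with rfl | rfl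
          · have : i = T.kIdx := Fin.ext (by simp [Simplex.kIdx, hk, hik])
            simp [Simplex.child1, this]
          · simp [Simplex.child2, hk, hik]
        rw [hv, hb]
        omega
      · have hv : T'.vertex i = T.vertex i := by
          rcases hc with rfl | rfl
          · have : i ≠ T.kIdx := fun e => hik (by rw [e]; exact hk)
            simp [Simplex.child1, this]
          · have : ¬ (i : ℕ) < d - r := by omega
            simp [Simplex.child2, hk, hik, this]
        rw [hv, h.new i (by omega)]
    have hold : ∃ t ≤ 1, ∀ i : Fin (d + 1), (i : ℕ) < d - r → ∃ j : Fin (d + 1),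
        (j : ℕ) = t + i ∧ T'.vertex i = T.vertex j := by
      rcases hc with rfl | rfl
      · refine ⟨0, by omega, fun i hi => ⟨i, by omega, ?_⟩⟩
        have : i ≠ T.kIdx := fun e => by
          rw [e] at hi
          exact absurd hk hi.ne
        simp [Simplex.child1, this]
      · refine ⟨1, le_rfl, fun i hi => ⟨⟨i + 1, by omega⟩, by simp; omega, ?_⟩⟩
        simp [Simplex.child2, hk, hi]
    obtain ⟨t, ht, hold⟩ := hold
    by_cases hwrap : r + 1 = d
    · refine ⟨q + 1, 0, 0, ?_, hd, le_rfl, ?_, ?_, ?_⟩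
      · rw [hgen, mul_add]
        omega
      · intro i hi
        omega
      · intro i _ hi
        rw [hnew i (by omega)]
        push_cast
        ring
      · intro _
        obtain ⟨j, hj, hv⟩ := hold 0 (by simp; omega)
        rw [hv]
        have := h.vgen_le j (by simp at hj; omega)
        push_cast
        linarith
    · refine ⟨q, r + 1, s + t, hgen, by omega, by have := h.s_le; omega, hnew, ?_, ?_⟩
      · intro i hi hpos
        obtain ⟨j, hj, hv⟩ := hold i (by omega)
        rw [hv, h.old j (by omega) (by omega), hj]
        push_cast
        ring
      · intro hst
        obtain ⟨j, hj, hv⟩ := hold 0 (by simp; omega)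
        have hj0 : j = 0 := Fin.ext (by rw [hj, Fin.val_zero]; omega)
        rw [hv, hj0]
        exact h.first (by omega)

/-- Two families on `Fin n` along which `f` is strictly decreasing coincide if the range of one
contains the range of the other. -/
lemma eq_of_strictAnti_comp {α : Type*} {n : ℕ} {f : α → ℤ} {u w : Fin n → α}
    (hu : StrictAnti (f ∘ u)) (hw : StrictAnti (f ∘ w)) (h : Set.range u ⊆ Set.range w) :
    u = w := by
  choose τ hτ using fun i => h (Set.mem_range_self i)
  have hmono : StrictMono τ := fun i j hij => by
    have := hu hij
    simp only [Function.comp_apply, ← hτ] at this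
    exact hw.lt_iff_gt.1 this
  funext i
  rw [← hτ i, le_antisymm hmono.apply_le hmono.le_apply]

/-- The position, in Maubach's ordering, of the `i`-th vertex in the order of decreasing
generation. -/
def sortedPos (d r s : ℕ) (i : Fin (d + 1)) : Fin (d + 1) :=
  if (i : ℕ) < r then Fin.ofNat (d + 1) (d - r + 1 + i)
  else if s = 0 then (if (i : ℕ) = d then 0 else Fin.ofNat (d + 1) (i - r + 1))
  else Fin.ofNat (d + 1) (i - r)

lemma sortedPos_val {d r s : ℕ} (hr : r < d) (i : Fin (d + 1)) :
    (sortedPos d r s i : ℕ) = if (i : ℕ) < r then d - r + 1 + i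
      else if s = 0 then (if (i : ℕ) = d then 0 else i - r + 1) else i - r := by
  unfold sortedPos
  split_ifs
  · exact Nat.mod_eq_of_lt (by omega)
  · rfl
  · exact Nat.mod_eq_of_lt (by omega)
  · exact Nat.mod_eq_of_lt (by omega)

namespace GenPattern

variable {S : ColoredSetup d} {T : Simplex d} {q r s : ℕ}

lemma vgen_sortedPos_of_lt (h : GenPattern S T q r s) (i : Fin (d + 1)) (hi : (i : ℕ) < r) :
    S.vgen (T.vertex (sortedPos d r s i)) = d * q + r - (i : ℕ) := by
  have hv := sortedPos_val (s := s) h.r_lt i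
  have hr := h.r_lt
  rw [if_pos hi] at hv
  rw [h.new _ (by omega), hv]
  omega

lemma vgen_sortedPos_of_ge (h : GenPattern S T q r s) (i : Fin (d + 1)) (hi : r ≤ (i : ℕ))
    (hs : 0 < s ∨ (i : ℕ) < d) :
    S.vgen (T.vertex (sortedPos d r s i)) = d * q + r - (i : ℕ) - (s - 1 : ℕ) := by
  have hv := sortedPos_val (s := s) h.r_lt i
  have hr := h.r_lt
  rw [if_neg (by omega)] at hv
  by_cases hs0 : s = 0
  · rw [if_pos hs0, if_neg (by omega)] at hv
    rw [h.old _ (by omega) (by omega), hv]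
    omega
  · rw [if_neg hs0] at hv
    rw [h.old _ (by omega) (by omega), hv]
    omega

lemma sortedPos_last (h : GenPattern S T q r 0) : sortedPos d r 0 (Fin.last d) = 0 := by
  have hr := h.r_lt
  apply Fin.ext
  rw [sortedPos_val h.r_lt]
  simp
  omega

lemma strictAnti_sortedPos (h : GenPattern S T q r s) :
    StrictAnti (S.vgen ∘ (T.vertex ∘ sortedPos d r s)) := by
  intro i j hij
  have hr := h.r_lt
  have hij' : (i : ℕ) < j := hij
  simp only [Function.comp_apply]
  have hi : (d : ℤ) * q + r - (i : ℕ) - (s - 1 : ℕ) ≤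
      S.vgen (T.vertex (sortedPos d r s i)) := by
    by_cases hir : (i : ℕ) < r
    · rw [h.vgen_sortedPos_of_lt i hir]
      omega
    · rw [h.vgen_sortedPos_of_ge i (by omega) (by omega)]
  by_cases hjr : (j : ℕ) < r
  · rw [h.vgen_sortedPos_of_lt i (by omega), h.vgen_sortedPos_of_lt j hjr]
    omega
  · by_cases hlast : s = 0 ∧ (j : ℕ) = d
    · obtain ⟨rfl, hj⟩ := hlast
      obtain rfl : j = Fin.last d := Fin.ext hj
      rw [h.sortedPos_last]
      have := h.first rfl
      omega
    · rw [h.vgen_sortedPos_of_ge j (by omega) (by omega)]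
      by_cases hir : (i : ℕ) < r
      · rw [h.vgen_sortedPos_of_lt i hir]
        omega
      · rw [h.vgen_sortedPos_of_ge i (by omega) (by omega)]
        omega

lemma lvlV_sortedPos_of_lt (h : GenPattern S T q r s) (i : Fin (d + 1)) (hi : (i : ℕ) < r) :
    S.lvlV (T.vertex (sortedPos d r s i)) = q + 1 := by
  have hr := h.r_lt
  apply lvlZ_eq_s3 <;> rw [h.vgen_sortedPos_of_lt i hi, mul_add] <;> omega

lemma lvlV_sortedPos_of_ge (h : GenPattern S T q r s) (i : Fin (d + 1)) (hi : r ≤ (i : ℕ))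
    (hs : 0 < s ∨ (i : ℕ) < d) :
    S.lvlV (T.vertex (sortedPos d r s i)) = q := by
  have hr := h.r_lt
  have hsr := h.s_le
  apply lvlZ_eq_s3 <;> rw [h.vgen_sortedPos_of_ge i hi hs] <;> omega

end GenPattern

theorem bisection_edge_gen_sorted (d : ℕ) (hd : 2 ≤ d) (S : ColoredSetup d)
    (T : Simplex d) (hT : MemM S.T0 T)
    (w : Fin (d + 1) → Pt d) (hw : Set.range w = T.V)
    (hsort : ∀ i j : Fin (d + 1), i < j → S.vgen (w j) < S.vgen (w i)) :
    (S.lvlV (w ⟨d - 1, by omega⟩) ≠ S.lvlV (w (Fin.last d)) →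
      (∀ i : Fin (d + 1), (i : ℕ) < d → S.lvlV (w (Fin.last d)) < S.lvlV (w i)) ∧
      T.bse = s(w ⟨d - 1, by omega⟩, w (Fin.last d))) ∧
    (S.lvlV (w ⟨d - 1, by omega⟩) = S.lvlV (w (Fin.last d)) →
      S.typV (w 0) < d ∧
      (∀ i : Fin (d + 1), S.typV (w 0) ≤ ((i : ℕ) : ℤ) →
        S.lvlV (w i) = S.lvlV (w (Fin.last d))) ∧
      (∀ i : Fin (d + 1), ((i : ℕ) : ℤ) < S.typV (w 0) →
        S.lvlV (w (Fin.last d)) < S.lvlV (w i)) ∧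
      (∀ i : Fin (d + 1), ((i : ℕ) : ℤ) = S.typV (w 0) →
        T.bse = s(w i, w (Fin.last d)))) := by
  obtain ⟨q, r, s, h⟩ := exists_genPattern (by omega) S hT
  have hr := h.r_lt
  have hsr := h.s_le
  obtain rfl : T.vertex ∘ sortedPos d r s = w := by
    refine eq_of_strictAnti_comp h.strictAnti_sortedPos hsort ?_
    rw [hw]
    exact Set.range_comp_subset_range _ _
  have hprev := h.lvlV_sortedPos_of_ge ⟨d - 1, by omega⟩ (by simp; omega) (by simp; omega)
  simp only [Function.comp_apply]
  rw [hprev]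
  rcases Nat.eq_zero_or_pos s with rfl | hs
  · have hlast : S.lvlV (T.vertex (sortedPos d r 0 (Fin.last d))) < q := by
      rw [h.sortedPos_last]
      exact lvlZ_lt d (by omega) (h.first rfl)
    refine ⟨fun _ => ⟨fun i hi => ?_, ?_⟩, fun he => absurd he hlast.ne'⟩
    · by_cases hir : (i : ℕ) < r
      · rw [h.lvlV_sortedPos_of_lt i hir]
        omega
      · rwa [h.lvlV_sortedPos_of_ge i (by omega) (by omega)]
    · have hpos : sortedPos d r 0 ⟨d - 1, by omega⟩ = T.kIdx := by
        apply Fin.ext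
        rw [sortedPos_val hr]
        simp only [Simplex.kIdx, h.k_eq]
        split_ifs <;> omega
      rw [h.sortedPos_last, hpos, Simplex.bse, Sym2.eq_swap]
  · rw [h.lvlV_sortedPos_of_ge (Fin.last d) (by simp; omega) (Or.inl hs)]
    have htyp : S.typV (T.vertex (sortedPos d r s 0)) = r := by
      have hl := h.lvlV_sortedPos_of_lt 0 (by simp; omega)
      have hg := h.vgen_sortedPos_of_lt 0 (by simp; omega)
      unfold ColoredSetup.lvlV at hl
      rw [ColoredSetup.typV, typZ, hl, hg]
      simp
    rw [htyp]
    refine ⟨fun hne => absurd rfl hne, fun _ => ⟨by omega, fun i hi => ?_, fun i hi => ?_,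
      fun i hi => ?_⟩⟩
    · exact h.lvlV_sortedPos_of_ge i (by omega) (Or.inl hs)
    · rw [h.lvlV_sortedPos_of_lt i (by omega)]
      omega
    · have hfst : sortedPos d r s i = 0 := by
        apply Fin.ext
        rw [sortedPos_val hr, if_neg (by omega), if_neg (by omega)]
        simp
        omega
      have hsnd : sortedPos d r s (Fin.last d) = T.kIdx := by
        apply Fin.ext
        rw [sortedPos_val hr, if_neg (by simp; omega), if_neg (by omega)]
        simp [Simplex.kIdx, h.k_eq]
      rw [hfst, hsnd, Simplex.bse]

end BisecGrading
end
end

section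
/- Let 𝒯_0 be a colored initial triangulation and let T = ⟨v_0,…,v_{ℓ−1} ∥ v_ℓ,…,v_d⟩ ∈ 𝒯 ∈ Bisec(𝒯_0) with ℓ ∈ {1,…,d} be a d-simplex with bisection edge bse(T) and bisection vertex b. Then: (1) both head(T) and tail(T) consist of vertices with consecutive generations; (2) if level(v_d) = level(v_{d−1}), then level(v_{ℓ−1}) = level(v_ℓ)+1, gen(v_0) = gen(v_d) + 2d − type(v_ℓ) = gen(v_d) + 2d − type(tail(T)), and there is no level jump within head(T); (3) if level(v_d) ≠ level(v_{d−1}), then level(v_0) = level(v_{d−1}) if and only if type(T) = d, i.e. there is no level jump within head(T) if and only if type(T) = d; (4) level(b) = level(bse(T)) + 1. -/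
noncomputable section

namespace BisecGrading

variable {d : ℕ}

theorem lvlZ_eq_of_mem {d : ℕ} {g L : ℤ} (h₁ : d * L - d < g) (h₂ : g ≤ d * L) :
    lvlZ d g = L := by
  unfold lvlZ
  have hd : (0 : ℤ) < d := by omega
  apply le_antisymm
  · apply Int.lt_add_one_iff.mp
    rw [Int.ediv_lt_iff_lt_mul hd]
    linarith [mul_comm (d : ℤ) L, add_mul L 1 (d : ℤ)]
  · rw [Int.le_ediv_iff_mul_le hd]
    linarith [mul_comm (d : ℤ) L]

theorem lvlZ_le_of_le {d : ℕ} (hd : 0 < d) {g L : ℤ} (h : g ≤ d * L) : lvlZ d g ≤ L := by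
  unfold lvlZ
  have hd : (0 : ℤ) < d := by omega
  apply Int.lt_add_one_iff.mp
  rw [Int.ediv_lt_iff_lt_mul hd]
  linarith [mul_comm (d : ℤ) L, add_mul L 1 (d : ℤ)]

theorem Refines.memM {T0 𝒯₁ 𝒯₂ : Finset (Simplex d)} (h : Refines 𝒯₁ 𝒯₂)
    (h₁ : ∀ T ∈ 𝒯₁, MemM T0 T) : ∀ T ∈ 𝒯₂, MemM T0 T := by
  induction h with
  | refl => exact h₁
  | step T _ hT ih =>
    intro T' hT'
    simp only [Finset.mem_insert, Finset.mem_erase] at hT'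
    rcases hT' with rfl | rfl | hT'
    · exact .child (ih T hT) (.inl rfl)
    · exact .child (ih T hT) (.inr rfl)
    · exact ih T' hT'.2

/-- The vertex generations of a simplex of generation `d * q + r`, position by position in
Maubach's ordering; `s` counts the second children taken since generation `d * q`. -/
structure IsGraded (S : ColoredSetup d) (T : Simplex d) (q r s : ℕ) : Prop where
  gen_eq : T.gen = d * q + r
  r_lt : r < d
  s_le : s ≤ r
  high : ∀ j : Fin (d + 1), d - r < (j : ℕ) → S.vgen (T.vertex j) = d * q + d + 1 - (j : ℕ)
  low : ∀ j : Fin (d + 1), 1 ≤ (j : ℕ) → (j : ℕ) ≤ d - r →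
    S.vgen (T.vertex j) = d * q + 1 - s - (j : ℕ)
  zero : (1 ≤ s ∧ S.vgen (T.vertex 0) = d * q + 1 - s) ∨
    (s = 0 ∧ S.vgen (T.vertex 0) ≤ d * q - d)

namespace IsGraded

variable {S : ColoredSetup d} {T : Simplex d} {q r s : ℕ}

theorem k_eq (h : IsGraded S T q r s) : T.k = d - r := by
  rw [Simplex.k, h.gen_eq, Nat.mul_add_mod, Nat.mod_eq_of_lt h.r_lt]

/-- A generation step within a block of `d` generations, or into the next block. -/
theorem of_step {T' : Simplex d} {s' : ℕ} (h : IsGraded S T q r s)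
    (hg : T'.gen = T.gen + 1) (hs : s' ≤ r + 1)
    (high : ∀ j : Fin (d + 1), d - r ≤ (j : ℕ) →
      S.vgen (T'.vertex j) = d * q + d + 1 - (j : ℕ))
    (low : ∀ j : Fin (d + 1), 1 ≤ (j : ℕ) → (j : ℕ) < d - r →
      S.vgen (T'.vertex j) = d * q + 1 - s' - (j : ℕ))
    (zero : (1 ≤ s' ∧ S.vgen (T'.vertex 0) = d * q + 1 - s') ∨
      (s' = 0 ∧ S.vgen (T'.vertex 0) ≤ d * q - d)) :
    ∃ q' r' s', IsGraded S T' q' r' s' := by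
  have hr := h.r_lt
  have hg' := h.gen_eq
  by_cases hrd : r + 1 < d
  · exact ⟨q, r + 1, s', by omega, hrd, hs, fun j hj => high j (by omega),
      fun j h1 h2 => low j h1 (by omega), zero⟩
  · refine ⟨q + 1, 0, 0, by rw [Nat.mul_add]; omega, by omega, le_rfl, fun j hj => ?_,
      fun j h1 _ => ?_, .inr ⟨rfl, ?_⟩⟩
    · have := j.isLt
      omega
    · rw [high j (by omega)]
      push_cast
      ring
    · push_cast
      rw [mul_add]
      omega

theorem child1 (h : IsGraded S T q r s) (hb : S.vgen T.bsv = (T.gen : ℤ) + 1) :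
    ∃ q' r' s', IsGraded S T.child1 q' r' s' := by
  have hr := h.r_lt
  have hs := h.s_le
  have hk := h.k_eq
  have hg := h.gen_eq
  have hne : ∀ j : Fin (d + 1), (j : ℕ) ≠ d - r → T.child1.vertex j = T.vertex j := by
    intro j hj
    refine Function.update_of_ne (fun hjk => hj ?_) _ _
    rw [hjk, ← hk]
    rfl
  have heq : ∀ j : Fin (d + 1), (j : ℕ) = d - r → T.child1.vertex j = T.bsv := by
    intro j hj
    have : j = T.kIdx := Fin.ext (by rw [hj, ← hk]; rfl)
    rw [this]
    exact Function.update_self _ _ _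
  refine h.of_step (s' := s) rfl (by omega) (fun j hj => ?_) (fun j h1 h2 => ?_) ?_
  · rcases hj.lt_or_eq with hlt | he
    · rw [hne j (by omega), h.high j hlt]
    · rw [heq j he.symm, hb, hg]
      push_cast
      omega
  · rw [hne j (by omega), h.low j h1 h2.le]
  · rw [hne 0 (by simp only [Fin.val_zero]; omega)]
    exact h.zero

theorem child2 (h : IsGraded S T q r s) (hb : S.vgen T.bsv = (T.gen : ℤ) + 1) :
    ∃ q' r' s', IsGraded S T.child2 q' r' s' := by
  have hr := h.r_lt
  have hs := h.s_le
  have hk := h.k_eq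
  have hg := h.gen_eq
  have hlow : ∀ j : Fin (d + 1), (j : ℕ) < d - r →
      S.vgen (T.child2.vertex j) = d * q + 1 - (s + 1 : ℕ) - (j : ℕ) := by
    intro j hj
    have : T.child2.vertex j = T.vertex ⟨(j : ℕ) + 1, by omega⟩ := dif_pos (hk ▸ hj)
    rw [this, h.low _ (by simp) (by simpa using hj)]
    push_cast
    ring
  refine h.of_step (s' := s + 1) rfl (by omega) (fun j hj => ?_) (fun j h1 h2 => hlow j h2) ?_
  · rcases hj.lt_or_eq with hlt | he
    · have : T.child2.vertex j = T.vertex j := by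
        simp only [Simplex.child2, hk]
        rw [dif_neg (by omega), if_neg (by omega)]
      rw [this, h.high j hlt]
    · have : T.child2.vertex j = T.bsv := by
        simp only [Simplex.child2, hk]
        rw [dif_neg (by omega), if_pos he.symm]
      rw [this, hb, hg]
      push_cast
      omega
  · refine .inl ⟨by omega, ?_⟩
    rw [hlow 0 (by simp only [Fin.val_zero]; omega)]
    simp

/-- The bisection vertex lies one level above the bisection edge. -/
theorem lvlV_bsv (h : IsGraded S T q r s) (hb : S.vgen T.bsv = (T.gen : ℤ) + 1) :
    S.lvlV T.bsv = S.lvlE T.bse + 1 := by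
  have hr := h.r_lt
  have hs := h.s_le
  have hg := h.gen_eq
  have hk : ((T.kIdx : Fin (d + 1)) : ℕ) = d - r := h.k_eq
  have hvk := h.low T.kIdx (by omega) (by omega)
  have hE : S.lvlE T.bse = lvlZ d (max (S.vgen (T.vertex 0)) (S.vgen (T.vertex T.kIdx))) := rfl
  have hb' : S.lvlV T.bsv = q + 1 := by
    apply lvlZ_eq_of_mem <;> rw [hb, hg, mul_add] <;> push_cast <;> omega
  have he : S.lvlE T.bse = q := by
    rw [hE]
    have := h.zero
    apply lvlZ_eq_of_mem <;> omega
  rw [hb', he]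

end IsGraded

theorem MemM.isGraded {S : ColoredSetup d} (hd : 0 < d) {T : Simplex d} (h : MemM S.T0 T) :
    ∃ q r s, IsGraded S T q r s := by
  induction h with
  | @init T hT =>
    refine ⟨0, 0, 0, by simp [S.gen_zero T hT], hd, le_rfl, fun j hj => ?_, fun j h1 _ => ?_,
      .inr ⟨rfl, ?_⟩⟩
    · have := j.isLt
      omega
    · rw [S.vgen_init T hT, S.color_succ T hT j (by omega)]
      push_cast [h1]
      ring
    · rw [S.vgen_init T hT, S.color_zero T hT]
      simp
  | @child T T' hT hc ih =>
    obtain ⟨q, r, s, ih⟩ := ih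
    rcases hc with rfl | rfl
    · exact ih.child1 (S.vgen_bsv T hT)
    · exact ih.child2 (S.vgen_bsv T hT)

namespace IsGraded

variable {S : ColoredSetup d} {T : Simplex d} {q r s : ℕ} {w : Fin (d + 1) → Pt d}

/-- The decreasing list of vertex generations is any strictly decreasing list which attains
exactly the vertex generations. -/
theorem vgen_sorted_eq (hw : Set.range w = T.V)
    (hsort : ∀ i j : Fin (d + 1), i < j → S.vgen (w j) < S.vgen (w i))
    {f : Fin (d + 1) → ℤ} (hf : StrictAnti f)
    (h₁ : ∀ j, ∃ i, f i = S.vgen (T.vertex j)) (h₂ : ∀ i, ∃ j, S.vgen (T.vertex j) = f i)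
    (i : Fin (d + 1)) : S.vgen (w i) = f i := by
  refine congrFun ((StrictAnti.range_inj (f := fun i => S.vgen (w i))
    (fun i j hij => hsort i j hij) hf).1 ?_) i
  have : Set.range (fun i => S.vgen (w i)) = Set.range (fun j => S.vgen (T.vertex j)) := by
    simpa only [Simplex.V, ← Set.range_comp, Function.comp_def] using congrArg (S.vgen '' ·) hw
  rw [this]
  apply Set.Subset.antisymm
  · rintro _ ⟨j, rfl⟩
    exact h₁ j
  · rintro _ ⟨i, rfl⟩
    exact h₂ i

theorem vgen_sorted_of_pos (h : IsGraded S T q r s) (hs : 1 ≤ s) (hw : Set.range w = T.V)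
    (hsort : ∀ i j : Fin (d + 1), i < j → S.vgen (w j) < S.vgen (w i)) (i : Fin (d + 1)) :
    S.vgen (w i) = if (i : ℕ) < r then (d * q + r - (i : ℕ) : ℤ)
      else d * q + 1 - s - ((i : ℕ) - r) := by
  have hr := h.r_lt
  have hsr := h.s_le
  have hlow : ∀ j : Fin (d + 1), (j : ℕ) ≤ d - r →
      S.vgen (T.vertex j) = d * q + 1 - s - (j : ℕ) := by
    intro j hj
    by_cases h0 : j = 0
    · subst h0
      have := h.zero
      simp only [Fin.val_zero]
      omega
    · exact h.low j (Nat.pos_of_ne_zero fun hj => h0 (Fin.ext hj)) hj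
  refine vgen_sorted_eq hw hsort (f := fun i : Fin (d + 1) =>
    if (i : ℕ) < r then (d * q + r - (i : ℕ) : ℤ) else d * q + 1 - s - ((i : ℕ) - r))
    ?_ ?_ ?_ i
  · intro i j hij
    have hij' : (i : ℕ) < j := hij
    dsimp only
    split_ifs <;> omega
  · intro j
    have hj := j.isLt
    by_cases hjr : (j : ℕ) ≤ d - r
    · refine ⟨⟨r + j, by omega⟩, ?_⟩
      rw [hlow j hjr]
      dsimp only
      split_ifs <;> omega
    · refine ⟨⟨j - (d - r) - 1, by omega⟩, ?_⟩
      rw [h.high j (by omega)]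
      dsimp only
      split_ifs <;> omega
  · intro i
    have hi := i.isLt
    by_cases hir : (i : ℕ) < r
    · refine ⟨⟨i + (d - r) + 1, by omega⟩, ?_⟩
      rw [h.high _ (by dsimp only; omega)]
      dsimp only
      split_ifs
      omega
    · refine ⟨⟨i - r, by omega⟩, ?_⟩
      rw [hlow _ (by dsimp only; omega)]
      dsimp only
      split_ifs
      omega

theorem vgen_sorted_of_zero (h : IsGraded S T q r 0) (hw : Set.range w = T.V)
    (hsort : ∀ i j : Fin (d + 1), i < j → S.vgen (w j) < S.vgen (w i)) (i : Fin (d + 1)) :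
    S.vgen (w i) = if (i : ℕ) < d then (d * q + r - (i : ℕ) : ℤ)
      else S.vgen (T.vertex 0) := by
  have hr := h.r_lt
  have h0 := h.zero
  refine vgen_sorted_eq hw hsort (f := fun i : Fin (d + 1) =>
    if (i : ℕ) < d then (d * q + r - (i : ℕ) : ℤ) else S.vgen (T.vertex 0)) ?_ ?_ ?_ i
  · intro i j hij
    have hij' : (i : ℕ) < j := hij
    dsimp only
    split_ifs <;> omega
  · intro j
    have hj := j.isLt
    by_cases hj0 : j = 0
    · subst hj0
      exact ⟨Fin.last d, if_neg (by simp)⟩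
    have hj1 : 1 ≤ (j : ℕ) := Nat.pos_of_ne_zero fun hj => hj0 (Fin.ext hj)
    by_cases hjr : (j : ℕ) ≤ d - r
    · refine ⟨⟨r + j - 1, by omega⟩, ?_⟩
      rw [h.low j hj1 hjr]
      dsimp only
      split_ifs <;> omega
    · refine ⟨⟨j - (d - r) - 1, by omega⟩, ?_⟩
      rw [h.high j (by omega)]
      dsimp only
      split_ifs <;> omega
  · intro i
    have hi := i.isLt
    by_cases hid : (i : ℕ) = d
    · exact ⟨0, (if_neg (by omega)).symm⟩
    by_cases hir : (i : ℕ) < r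
    · refine ⟨⟨i + (d - r) + 1, by omega⟩, ?_⟩
      rw [h.high _ (by dsimp only; omega)]
      dsimp only
      split_ifs <;> omega
    · refine ⟨⟨i - r + 1, by omega⟩, ?_⟩
      rw [h.low _ (by dsimp only; omega) (by dsimp only; omega)]
      dsimp only
      split_ifs <;> omega

theorem typ_eq_iff (h : IsGraded S T q r s) : T.typ = d ↔ r = 0 := by
  have hr := h.r_lt
  have hg : (T.gen : ℤ) = d * q + r := by exact_mod_cast h.gen_eq
  rw [Simplex.typ, typZ, hg]
  rcases Nat.eq_zero_or_pos r with h0 | h0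
  · rw [lvlZ_eq_of_mem (L := q) (by omega) (by omega), mul_sub]
    omega
  · rw [lvlZ_eq_of_mem (L := q + 1) (by rw [mul_add]; omega) (by rw [mul_add]; omega)]
    rw [add_sub_cancel_right]
    omega

end IsGraded

theorem gen_sorted_structure (d : ℕ) (hd : 2 ≤ d) (S : ColoredSetup d)
    (𝒯 : Finset (Simplex d)) (h𝒯 : 𝒯 ∈ Bisec S.T0) (T : Simplex d) (hT : T ∈ 𝒯)
    (w : Fin (d + 1) → Pt d) (hw : Set.range w = T.V)
    (hsort : ∀ i j : Fin (d + 1), i < j → S.vgen (w j) < S.vgen (w i))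
    (ℓ : ℕ) (hℓ1 : 1 ≤ ℓ) (hℓd : ℓ ≤ d)
    (hjump : S.lvlV (w ⟨ℓ, by omega⟩) < S.lvlV (w ⟨ℓ - 1, by omega⟩))
    (htail : ∀ i : Fin (d + 1), ℓ ≤ (i : ℕ) → S.lvlV (w i) = S.lvlV (w (Fin.last d))) :
    ((∀ i i' : Fin (d + 1), (i' : ℕ) = (i : ℕ) + 1 → (i' : ℕ) ≤ ℓ - 1 →
        S.vgen (w i) = S.vgen (w i') + 1) ∧
      (∀ i i' : Fin (d + 1), (i' : ℕ) = (i : ℕ) + 1 → ℓ ≤ (i : ℕ) →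
        S.vgen (w i) = S.vgen (w i') + 1)) ∧
    (S.lvlV (w (Fin.last d)) = S.lvlV (w ⟨d - 1, by omega⟩) →
      S.lvlV (w ⟨ℓ - 1, by omega⟩) = S.lvlV (w ⟨ℓ, by omega⟩) + 1 ∧
      S.vgen (w 0) = S.vgen (w (Fin.last d)) + 2 * d - S.typV (w ⟨ℓ, by omega⟩) ∧
      (∀ i : Fin (d + 1), (i : ℕ) ≤ ℓ - 1 → S.lvlV (w i) = S.lvlV (w 0))) ∧
    (S.lvlV (w (Fin.last d)) ≠ S.lvlV (w ⟨d - 1, by omega⟩) →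
      (S.lvlV (w 0) = S.lvlV (w ⟨d - 1, by omega⟩) ↔ T.typ = d)) ∧
    S.lvlV T.bsv = S.lvlE T.bse + 1 := by
  have hTM : MemM S.T0 T := h𝒯.1.memM (fun _ h => .init h) T hT
  obtain ⟨q, r, s, h⟩ := hTM.isGraded (by omega)
  have hr := h.r_lt
  have hsr := h.s_le
  have hup : ∀ v, (d * q : ℤ) < S.vgen v → S.vgen v ≤ d * q + d → S.lvlV v = q + 1 :=
    fun v h₁ h₂ => lvlZ_eq_of_mem (by rw [mul_add]; omega) (by rw [mul_add]; omega)
  have hmid : ∀ v, (d * q - d : ℤ) < S.vgen v → S.vgen v ≤ d * q → S.lvlV v = q :=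
    fun v h₁ h₂ => lvlZ_eq_of_mem h₁ h₂
  rw [← and_assoc, ← and_assoc]
  refine ⟨?_, h.lvlV_bsv (S.vgen_bsv T hTM)⟩
  rw [and_assoc]
  rcases Nat.eq_zero_or_pos s with rfl | hs
  · have hv := h.vgen_sorted_of_zero hw hsort
    have hx : S.vgen (T.vertex 0) ≤ d * q - d := by
      have := h.zero
      omega
    have hlast : S.lvlV (w (Fin.last d)) ≤ q - 1 := by
      refine lvlZ_le_of_le (by omega) ?_
      rw [hv, if_neg (by simp), mul_sub, mul_one]
      exact hx
    have hprev : S.lvlV (w ⟨d - 1, by omega⟩) = q := by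
      apply hmid <;> rw [hv, if_pos (by dsimp only; omega)] <;> dsimp only <;> omega
    have hℓ : ℓ = d := by
      by_contra hne
      have := htail ⟨d - 1, by omega⟩ (by dsimp only; omega)
      omega
    refine ⟨⟨fun i i' h1 h2 => ?_, fun i i' h1 h2 => ?_⟩, fun he => ?_, fun _ => ?_⟩
    · rw [hv, hv, if_pos (by omega), if_pos (by omega)]
      omega
    · have := i'.isLt
      omega
    · omega
    · rw [h.typ_eq_iff, hprev]
      have hv0 := hv 0
      rw [if_pos (by simp only [Fin.val_zero]; omega)] at hv0
      simp only [Fin.val_zero] at hv0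
      constructor
      · intro he
        by_contra hr0
        have := hup (w 0) (by omega) (by omega)
        omega
      · intro hr0
        exact hmid _ (by omega) (by omega)
  · have hv := h.vgen_sorted_of_pos hs hw hsort
    have hhead : ∀ i : Fin (d + 1), (i : ℕ) < r → S.lvlV (w i) = q + 1 := by
      intro i hi
      apply hup <;> rw [hv, if_pos hi] <;> omega
    have htl : ∀ i : Fin (d + 1), r ≤ (i : ℕ) → S.lvlV (w i) = q := by
      intro i hi
      have := i.isLt
      apply hmid <;> rw [hv, if_neg (by omega)] <;> omega
    have hlast : S.lvlV (w (Fin.last d)) = q := htl _ (by simp only [Fin.val_last]; omega)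
    have hprev : S.lvlV (w ⟨d - 1, by omega⟩) = q := htl _ (by dsimp only; omega)
    have hℓ : ℓ = r := by
      by_contra hne
      rcases Nat.lt_or_gt_of_ne hne with hlt | hgt
      · have h1 := htail ⟨ℓ, by omega⟩ le_rfl
        have h2 := hhead ⟨ℓ, by omega⟩ hlt
        omega
      · have h1 := htl ⟨ℓ, by omega⟩ hgt.le
        have h2 := htl ⟨ℓ - 1, by omega⟩ (by dsimp only; omega)
        omega
    subst hℓ
    refine ⟨⟨fun i i' h1 h2 => ?_, fun i i' h1 h2 => ?_⟩, fun _ => ⟨?_, ?_, ?_⟩,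
      fun hne => ?_⟩
    · rw [hv, hv, if_pos (by omega), if_pos (by omega)]
      omega
    · rw [hv, hv, if_neg (by omega), if_neg (by omega)]
      omega
    · rw [htl ⟨ℓ, by omega⟩ le_rfl, hhead ⟨ℓ - 1, by omega⟩ (by dsimp only; omega)]
    · have hty : S.typV (w ⟨ℓ, by omega⟩) = S.vgen (w ⟨ℓ, by omega⟩) - d * (q - 1) := by
        rw [← htl ⟨ℓ, by omega⟩ le_rfl]
        rfl
      rw [hty, hv, hv, hv, if_pos (by simp only [Fin.val_zero]; omega),
        if_neg (by simp only [Fin.val_last]; omega), if_neg (by dsimp only; omega), mul_sub]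
      simp only [Fin.val_zero, Fin.val_last]
      push_cast
      ring
    · intro i hi
      rw [hhead i (by omega), hhead 0 (by simp only [Fin.val_zero]; omega)]
    · omega

end BisecGrading
end
end

section
/- Let 𝒯_0 be a colored initial triangulation and let S = ⟨v_0,…,v_m⟩ (1 ≤ m ≤ d) be an m-subsimplex arising in the master tree 𝕄, with bisection edge bse(S) (the edge of S first bisected during the refinement process) and bisection vertex b (the midpoint of bse(S)). Then: (1) if level(v_m) ≠ level(v_{m−1}), then bse(S) = [v_{m−1}, v_m] and gen(b) = gen(v_{m−1}) + d; (2) if level(v_m) = level(v_{m−1}), then, with v_ℓ the youngest vertex of tail(S), bse(S) = [v_ℓ, v_m] and gen(b) = gen(v_m) + 2d + 1 − type(v_ℓ). -/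
noncomputable section

namespace BisecGrading

variable {d : ℕ}

lemma lvlZ_eq_iff {d : ℕ} (hd : 0 < d) (g q : ℤ) :
    lvlZ d g = q ↔ d * q - d < g ∧ g ≤ d * q := by
  have hd' : (0 : ℤ) < d := by exact_mod_cast hd
  unfold lvlZ
  rw [Int.ediv_eq_iff_of_pos hd']
  constructor
  · rintro ⟨h1, h2⟩
    constructor <;> nlinarith
  · rintro ⟨h1, h2⟩
    constructor <;> nlinarith

lemma Simplex.k_succ_cases (hd : 0 < d) {T T' : Simplex d}
    (h : T'.gen = T.gen + 1) :
    1 ≤ T.k ∧ ((T'.k + 1 = T.k ∧ T'.gen / d = T.gen / d) ∨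
      (T.k = 1 ∧ T'.k = d ∧ T'.gen / d = T.gen / d + 1)) ∧
    T.gen + T.k = d * (T.gen / d) + d := by
  have h1 := Nat.mod_lt T.gen hd
  have h2 := Nat.div_add_mod T.gen d
  unfold Simplex.k
  rw [h]
  refine ⟨by omega, ?_, by omega⟩
  by_cases hr : T.gen % d + 1 = d
  · right
    have h3 : T.gen + 1 = d * (T.gen / d + 1) := by rw [mul_add]; omega
    rw [h3, Nat.mul_mod_right, Nat.mul_div_cancel_left _ hd]
    omega
  · left
    have h3 : T.gen + 1 = (T.gen % d + 1) + d * (T.gen / d) := by omega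
    have h4 : T.gen % d + 1 < d := by omega
    have h5 : (T.gen + 1) % d = T.gen % d + 1 := by
      rw [h3, Nat.add_mul_mod_self_left, Nat.mod_eq_of_lt h4]
    have h6 : (T.gen + 1) / d = T.gen / d := by
      rw [h3, Nat.add_mul_div_left _ _ hd, Nat.div_eq_of_lt h4, zero_add]
    omega

namespace ColoredSetup

/-- The generations of the vertices of `T`, listed in Maubach's ordering: the positions beyond
`T.k` carry the vertices created at the current level, and the positions up to `T.k` carry
consecutive vertices of the previous level, possibly preceded by one vertex of lower level. -/
structure GenProfile {d : ℕ} (S : ColoredSetup d) (T : Simplex d) : Prop where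
  young : ∀ j : Fin (d + 1), T.k < j →
    S.vgen (T.vertex j) = d * (T.gen / d : ℕ) + d - j + 1
  old : (S.vgen (T.vertex 0) ≤ d * (T.gen / d : ℕ) - d ∧
      ∀ j : Fin (d + 1), 1 ≤ (j : ℕ) → (j : ℕ) ≤ T.k →
        S.vgen (T.vertex j) = d * (T.gen / d : ℕ) - j + 1) ∨
    ∃ a : ℕ, 1 ≤ a ∧ a + T.k ≤ d ∧ ∀ j : Fin (d + 1), (j : ℕ) ≤ T.k →
      S.vgen (T.vertex j) = d * (T.gen / d : ℕ) - a - j + 1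

variable {d : ℕ} {S : ColoredSetup d} {T : Simplex d}

lemma genProfile_init (hT : T ∈ S.T0) : S.GenProfile T := by
  have hk : T.k = d := by simp [Simplex.k, S.gen_zero T hT]
  refine ⟨fun j hj => by omega, Or.inl ⟨?_, fun j hj _ => ?_⟩⟩
  · simp [S.vgen_init T hT, S.color_zero T hT, S.gen_zero T hT]
  · rw [S.vgen_init T hT, S.color_succ T hT j (by omega), S.gen_zero T hT]
    simp only [Nat.zero_div]
    omega

lemma GenProfile.child1 (hd : 0 < d) (hT : MemM S.T0 T) (h : S.GenProfile T) :
    S.GenProfile T.child1 := by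
  obtain ⟨hk1, hcase, hsum⟩ := Simplex.k_succ_cases hd (T := T) (T' := T.child1) rfl
  have hkd := T.k_le
  have hnew : ∀ j : Fin (d + 1), (j : ℕ) = T.k →
      S.vgen (T.child1.vertex j) = (T.gen : ℤ) + 1 := by
    intro j hj
    have : j = T.kIdx := Fin.ext hj
    rw [this]
    simp [Simplex.child1, S.vgen_bsv T hT]
  have hold : ∀ j : Fin (d + 1), (j : ℕ) ≠ T.k →
      S.vgen (T.child1.vertex j) = S.vgen (T.vertex j) := by
    intro j hj
    have : j ≠ T.kIdx := fun h => hj (congrArg Fin.val h)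
    simp [Simplex.child1, this]
  obtain ⟨hy, ho⟩ := h
  zify at hsum
  have h00 := hold 0 (by simp; omega)
  rcases hcase with ⟨hk', hq⟩ | ⟨hk, hk', hq⟩
  · refine ⟨fun j hj => ?_, ?_⟩
    · rw [hq]
      by_cases hjk : (j : ℕ) = T.k
      · rw [hnew j hjk]
        push_cast
        omega
      · rw [hold j hjk, hy j (by omega)]
    · rw [hq]
      rcases ho with ⟨h0, h1⟩ | ⟨a, ha, hak, h1⟩
      · exact Or.inl ⟨h00 ▸ h0, fun j hj1 hj2 => by
          rw [hold j (by omega), h1 j hj1 (by omega)]⟩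
      · exact Or.inr ⟨a, ha, by omega, fun j hj => by
          rw [hold j (by omega), h1 j (by omega)]⟩
  · refine ⟨fun j hj => by omega, Or.inl ⟨?_, fun j hj1 hj2 => ?_⟩⟩
    · rw [hq, h00]
      push_cast at ho ⊢
      rw [mul_add]
      rcases ho with ⟨h0, h1⟩ | ⟨a, ha, hak, h1⟩
      · omega
      · have := h1 0 (by simp)
        simp only [Fin.val_zero] at this
        omega
    · rw [hq]
      by_cases hjk : (j : ℕ) = T.k
      · rw [hnew j hjk]
        push_cast
        rw [mul_add]
        omega
      · rw [hold j hjk, hy j (by omega)]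
        push_cast
        rw [mul_add]
        omega

lemma GenProfile.child2 (hd : 0 < d) (hT : MemM S.T0 T) (h : S.GenProfile T) :
    S.GenProfile T.child2 := by
  obtain ⟨hk1, hcase, hsum⟩ := Simplex.k_succ_cases hd (T := T) (T' := T.child2) rfl
  have hkd := T.k_le
  have hnew : ∀ j : Fin (d + 1), (j : ℕ) = T.k →
      S.vgen (T.child2.vertex j) = (T.gen : ℤ) + 1 := by
    intro j hj
    simp [Simplex.child2, hj, S.vgen_bsv T hT]
  have hold : ∀ j : Fin (d + 1), T.k < (j : ℕ) →
      S.vgen (T.child2.vertex j) = S.vgen (T.vertex j) := by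
    intro j hj
    simp [Simplex.child2, hj.ne', hj.not_gt]
  have hshift : ∀ j : Fin (d + 1), (j : ℕ) < T.k → ∃ i : Fin (d + 1), (i : ℕ) = j + 1 ∧
      S.vgen (T.child2.vertex j) = S.vgen (T.vertex i) := by
    intro j hj
    exact ⟨⟨j + 1, by omega⟩, rfl, by simp [Simplex.child2, hj]⟩
  obtain ⟨hy, ho⟩ := h
  zify at hsum
  rcases hcase with ⟨hk', hq⟩ | ⟨hk, hk', hq⟩
  · refine ⟨fun j hj => ?_, Or.inr ?_⟩
    · rw [hq]
      by_cases hjk : (j : ℕ) = T.k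
      · rw [hnew j hjk]
        push_cast
        omega
      · rw [hold j (by omega), hy j (by omega)]
    · rw [hq]
      rcases ho with ⟨h0, h1⟩ | ⟨a, ha, hak, h1⟩
      · refine ⟨1, le_rfl, by omega, fun j hj => ?_⟩
        obtain ⟨i, hi, hv⟩ := hshift j (by omega)
        rw [hv, h1 i (by omega) (by omega)]
        omega
      · refine ⟨a + 1, by omega, by omega, fun j hj => ?_⟩
        obtain ⟨i, hi, hv⟩ := hshift j (by omega)
        rw [hv, h1 i (by omega)]
        omega
  · refine ⟨fun j hj => by omega, Or.inl ⟨?_, fun j hj1 hj2 => ?_⟩⟩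
    · obtain ⟨i, hi, hv⟩ := hshift 0 (by simp; omega)
      simp only [Fin.val_zero] at hi
      rw [hq, hv]
      push_cast at ho ⊢
      rw [mul_add]
      rcases ho with ⟨h0, h1⟩ | ⟨a, ha, hak, h1⟩
      · rw [h1 i (by omega) (by omega)]
        omega
      · rw [h1 i (by omega)]
        omega
    · rw [hq]
      by_cases hjk : (j : ℕ) = T.k
      · rw [hnew j hjk]
        push_cast
        rw [mul_add]
        omega
      · rw [hold j (by omega), hy j (by omega)]
        push_cast
        rw [mul_add]
        omega

lemma genProfile_of_memM (hd : 0 < d) (hT : MemM S.T0 T) : S.GenProfile T := by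
  induction hT with
  | init h => exact genProfile_init h
  | child hT hc ih =>
    rcases hc with rfl | rfl
    · exact ih.child1 hd hT
    · exact ih.child2 hd hT

end ColoredSetup

lemma mem_of_mk_mem_edgeOfSet {A : Set (Pt d)} {a b : Pt d} (h : s(a, b) ∈ edgeOfSet A) :
    a ∈ A ∧ b ∈ A := by
  obtain ⟨x, hx, y, hy, -, hxy⟩ := h
  rcases Sym2.eq_iff.mp hxy with ⟨rfl, rfl⟩ | ⟨rfl, rfl⟩
  · exact ⟨hx, hy⟩
  · exact ⟨hy, hx⟩

/-- The first bisected edge of `A` is the bisection edge of a simplex of the master tree that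
contains `A`. -/
lemma FirstBisected.exists_bse {T0 : Finset (Simplex d)} {A : Set (Pt d)} {T : Simplex d}
    {e : Sym2 (Pt d)} (h : FirstBisected A T e) (hT : MemM T0 T) (hA : A ⊆ T.V) :
    ∃ T' : Simplex d, MemM T0 T' ∧ A ⊆ T'.V ∧ e = T'.bse ∧ T'.bse ∈ edgeOfSet A := by
  induction h with
  | found h => exact ⟨_, hT, hA, rfl, h⟩
  | step _ hc hA' _ ih => exact ih (hT.child hc) hA'

theorem subsimplex_bisection (d : ℕ) (hd : 2 ≤ d) (S : ColoredSetup d)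
    (m : ℕ) (hm1 : 1 ≤ m) (hmd : m ≤ d)
    (T : Simplex d) (hT : MemM S.T0 T)
    (w : Fin (m + 1) → Pt d) (hinj : Function.Injective w)
    (hsub : Set.range w ⊆ T.V)
    (hsort : ∀ i j : Fin (m + 1), i < j → S.vgen (w j) < S.vgen (w i))
    (e : Sym2 (Pt d)) (he : FirstBisected (Set.range w) T e) :
    (S.lvlV (w (Fin.last m)) ≠ S.lvlV (w ⟨m - 1, by omega⟩) →
      e = s(w ⟨m - 1, by omega⟩, w (Fin.last m)) ∧
      S.vgen (edgeMid e) = S.vgen (w ⟨m - 1, by omega⟩) + d) ∧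
    (S.lvlV (w (Fin.last m)) = S.lvlV (w ⟨m - 1, by omega⟩) →
      ∀ ℓ : Fin (m + 1),
        (S.lvlV (w ℓ) = S.lvlV (w (Fin.last m)) ∧
          ∀ i : Fin (m + 1), (i : ℕ) < (ℓ : ℕ) →
            S.lvlV (w i) ≠ S.lvlV (w (Fin.last m))) →
        e = s(w ℓ, w (Fin.last m)) ∧
        S.vgen (edgeMid e) = S.vgen (w (Fin.last m)) + 2 * d + 1 - S.typV (w ℓ)) := by
  obtain ⟨T', hT', hsub', rfl, hbse⟩ := he.exists_bse hT hsub
  clear he hsub hT T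
  have hd0 : 0 < d := by omega
  obtain ⟨⟨i0, hi0⟩, ⟨ik, hik⟩⟩ := mem_of_mk_mem_edgeOfSet hbse
  obtain ⟨hy, ho⟩ := S.genProfile_of_memM hd0 hT'
  obtain ⟨hk1, -, hsum⟩ := Simplex.k_succ_cases hd0 (T := T') (T' := T'.child1) rfl
  have hkd := T'.k_le
  have hmid : S.vgen (edgeMid T'.bse) = (T'.gen : ℤ) + 1 := S.vgen_bsv T' hT'
  have hmono : ∀ i j : Fin (m + 1), i ≤ j → S.vgen (w j) ≤ S.vgen (w i) := by
    intro i j hij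
    rcases hij.eq_or_lt with rfl | h
    · exact le_rfl
    · exact (hsort i j h).le
  have hbse' : T'.bse = s(w i0, w ik) := by rw [hi0, hik]; rfl
  have hkval : (T'.kIdx : ℕ) = T'.k := rfl
  have hpos : ∀ i, ∃ j, T'.vertex j = w i := fun i => hsub' ⟨i, rfl⟩
  have hlast : ∀ i : Fin (m + 1), i ≤ Fin.last m := Fin.le_last
  set P : ℤ := d * ((T'.gen / d : ℕ) : ℤ) with hP
  have hsum' : (T'.gen : ℤ) + T'.k = P + d := by
    rw [hP]
    exact_mod_cast hsum
  clear hsum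
  have hlvl : ∀ v, S.lvlV v = ((T'.gen / d : ℕ) : ℤ) ↔ P - d < S.vgen v ∧ S.vgen v ≤ P :=
    fun v => lvlZ_eq_iff hd0 _ _
  rcases ho with ⟨h0, h1⟩ | ⟨a, ha, hak, h1⟩
  · have hgk : S.vgen (w ik) = P - T'.k + 1 := by
      rw [hik, h1 T'.kIdx (by omega) (by omega), hkval]
    rw [← hi0] at h0
    have hother : ∀ i, i ≠ i0 → S.vgen (w ik) ≤ S.vgen (w i) := by
      intro i hi
      obtain ⟨j, hj⟩ := hpos i
      have hj0 : j ≠ 0 := by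
        rintro rfl
        exact hi (hinj (hj.symm.trans hi0.symm))
      have hj0' : (j : ℕ) ≠ 0 := fun h => hj0 (Fin.ext h)
      rw [hgk, ← hj]
      by_cases hjk : (j : ℕ) ≤ T'.k
      · rw [h1 j (by omega) hjk]
        omega
      · rw [hy j (by omega)]
        omega
    have hne : ik ≠ i0 := by
      rintro rfl
      omega
    have e0 : i0 = Fin.last m := by
      by_contra h
      have h2 := hother (Fin.last m) (Ne.symm h)
      have h3 := hmono i0 _ (hlast i0)
      omega
    have ek : ik = ⟨m - 1, by omega⟩ := by
      by_contra h
      have h4 : (⟨m - 1, by omega⟩ : Fin (m + 1)) ≠ i0 := by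
        rw [e0]
        intro h
        have := congrArg Fin.val h
        simp only [Fin.val_last] at this
        omega
      have h2 := hother _ h4
      have h3 := hsort ik ⟨m - 1, by omega⟩ (by
        rw [Fin.lt_def]
        have h5 : (ik : ℕ) ≠ m - 1 := fun h' => h (Fin.ext h')
        have h6 : (ik : ℕ) ≠ m := fun h' => hne (e0 ▸ Fin.ext h')
        have := ik.isLt
        simp only
        omega)
      omega
    subst e0
    rw [ek] at hgk hbse'
    refine ⟨fun _ => ⟨hbse'.trans Sym2.eq_swap, by omega⟩, fun h => ?_⟩
    have h2 := (hlvl _).mpr (show P - d < S.vgen (w ⟨m - 1, by omega⟩) ∧ _ by omega)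
    rw [← h] at h2
    have := (hlvl _).mp h2
    omega
  · have hgk : S.vgen (w ik) = P - a - T'.k + 1 := by
      rw [hik, h1 T'.kIdx (by omega), hkval]
    have hg0 : S.vgen (w i0) = P - a + 1 := by
      rw [hi0, h1 0 (by simp)]
      simp
    have hle : ∀ i, S.vgen (w ik) ≤ S.vgen (w i) ∧
        (S.vgen (w i) ≤ P → S.vgen (w i) ≤ S.vgen (w i0)) := by
      intro i
      obtain ⟨j, hj⟩ := hpos i
      rw [hgk, hg0, ← hj]
      by_cases hjk : (j : ℕ) ≤ T'.k
      · rw [h1 j hjk]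
        omega
      · rw [hy j (by omega)]
        omega
    have ek : ik = Fin.last m := by
      by_contra h
      have h2 := (hle (Fin.last m)).1
      have h3 := hsort ik _ (lt_of_le_of_ne (hlast ik) h)
      omega
    subst ek
    have hlk := (hlvl (w (Fin.last m))).mpr (by omega)
    have hi0m : (i0 : ℕ) ≤ m - 1 := by
      have : (i0 : ℕ) ≠ m := fun h => by
        have : i0 = Fin.last m := Fin.ext h
        subst this
        omega
      omega
    have hlm := (hlvl (w ⟨m - 1, by omega⟩)).mpr (by
      have h2 := hmono i0 ⟨m - 1, by omega⟩ hi0m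
      have h3 := (hle ⟨m - 1, by omega⟩).1
      omega)
    refine ⟨fun h => absurd (hlk.trans hlm.symm) h, fun _ ℓ ⟨hℓ, hmin⟩ => ?_⟩
    have hl0 := (hlvl (w i0)).mpr (by omega)
    have hℓ0 : ℓ = i0 := by
      by_contra h
      have h2 : ¬ (i0 : ℕ) < ℓ := fun h' => hmin i0 h' (hl0.trans hlk.symm)
      have h3 : ℓ < i0 := lt_of_le_of_ne (Fin.le_def.mpr (by omega)) h
      have h4 := hsort _ _ h3
      have h5 := (hle ℓ).2 ((hlvl _).mp (hℓ.trans hlk)).2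
      omega
    subst hℓ0
    refine ⟨hbse', ?_⟩
    have htyp : S.typV (w ℓ) = S.vgen (w ℓ) - d * (((T'.gen / d : ℕ) : ℤ) - 1) := by
      rw [← hl0]
      rfl
    rw [htyp, mul_sub, ← hP, hmid]
    omega

end BisecGrading
end
end

section
/- Let 𝒯_0 be a colored initial triangulation, let T ∈ 𝕄 be a d-simplex with child T_1, and let v ∈ 𝒱(T) ∩ 𝒱(T_1) be a vertex lying on the bisection edge bse(T). Then v lies on the bisection edge bse(T_1) of T_1. -/
noncomputable section

namespace BisecGrading

variable {d : ℕ}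

namespace Simplex

variable {d : ℕ}

lemma one_le_k (hd : 0 < d) (T : Simplex d) : 1 ≤ T.k := by
  have := Nat.mod_lt T.gen hd
  unfold k
  omega

lemma k_eq_of_gen_eq_succ {T T' : Simplex d} (hd : 0 < d) (h : T'.gen = T.gen + 1) :
    T'.k = if T.k = 1 then d else T.k - 1 := by
  have hlt := Nat.mod_lt T.gen hd
  have hmod := Nat.add_mod_eq_ite (k := d) (m := T.gen) (n := 1)
  unfold k
  rw [h]
  rcases Nat.lt_or_ge 1 d with h1 | h1
  · rw [Nat.mod_eq_of_lt h1] at hmod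
    split_ifs at hmod ⊢ <;> omega
  · obtain rfl : d = 1 := by omega
    simp [Nat.mod_one]

lemma child1_vertex_kIdx (T : Simplex d) : T.child1.vertex T.kIdx = T.bsv :=
  Function.update_self ..

lemma child1_vertex_of_ne (T : Simplex d) {i : Fin (d + 1)} (hi : (i : ℕ) ≠ T.k) :
    T.child1.vertex i = T.vertex i :=
  Function.update_of_ne (fun h => hi (congrArg Fin.val h)) ..

lemma child2_vertex_of_lt (T : Simplex d) {i : Fin (d + 1)} (hi : (i : ℕ) < T.k) :
    T.child2.vertex i = T.vertex ⟨i + 1, by have := T.k_le; omega⟩ :=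
  dif_pos hi

lemma child2_vertex_of_eq (T : Simplex d) {i : Fin (d + 1)} (hi : (i : ℕ) = T.k) :
    T.child2.vertex i = T.bsv := by
  simp [child2, hi]

lemma child2_vertex_of_gt (T : Simplex d) {i : Fin (d + 1)} (hi : T.k < i) :
    T.child2.vertex i = T.vertex i := by
  simp [child2, hi.not_gt, hi.ne']

/-- Every vertex of the first child is the bisection vertex or a vertex other than `v_k`. -/
lemma child1_vertex_cases (T : Simplex d) (i : Fin (d + 1)) :
    (i : ℕ) = T.k ∧ T.child1.vertex i = T.bsv ∨
      (i : ℕ) ≠ T.k ∧ T.child1.vertex i = T.vertex i := by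
  by_cases hi : (i : ℕ) = T.k
  · obtain rfl : i = T.kIdx := Fin.ext hi
    exact .inl ⟨rfl, T.child1_vertex_kIdx⟩
  · exact .inr ⟨hi, T.child1_vertex_of_ne hi⟩

/-- Every vertex of the second child is the bisection vertex or a shifted or kept vertex. -/
lemma child2_vertex_cases (T : Simplex d) (i : Fin (d + 1)) :
    (i : ℕ) = T.k ∧ T.child2.vertex i = T.bsv ∨
      ∃ j : Fin (d + 1), T.child2.vertex i = T.vertex j ∧
        ((i : ℕ) < T.k ∧ (j : ℕ) = i + 1 ∨ T.k < i ∧ j = i) := by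
  rcases lt_trichotomy (i : ℕ) T.k with hi | hi | hi
  · exact .inr ⟨_, T.child2_vertex_of_lt hi, .inl ⟨hi, rfl⟩⟩
  · exact .inl ⟨hi, T.child2_vertex_of_eq hi⟩
  · exact .inr ⟨_, T.child2_vertex_of_gt hi, .inr ⟨hi, rfl⟩⟩

end Simplex

namespace ColoredSetup

variable {d : ℕ} (S : ColoredSetup d)

/-- On a simplex of the master tree the vertex generations are pairwise distinct and bounded
by the generation of the simplex. -/
lemma vgen_vertex_le_and_injective {T : Simplex d} (hT : MemM S.T0 T) :
    (∀ i, S.vgen (T.vertex i) ≤ T.gen) ∧ Function.Injective fun i => S.vgen (T.vertex i) := by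
  induction hT with
  | @init T hT =>
    have hcol : ∀ i : Fin (d + 1),
        (i : ℕ) = 0 ∧ S.color (T.vertex i) = d ∨
          (i : ℕ) ≠ 0 ∧ S.color (T.vertex i) = (i : ℕ) - 1 := by
      intro i
      by_cases hi : (i : ℕ) = 0
      · obtain rfl : i = 0 := Fin.ext hi
        exact .inl ⟨rfl, S.color_zero T hT⟩
      · exact .inr ⟨hi, S.color_succ T hT i hi⟩
    refine ⟨fun i => ?_, fun i j hij => ?_⟩
    · rw [S.vgen_init T hT]
      omega
    · simp only [S.vgen_init T hT] at hij
      have hi := hcol i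
      have hj := hcol j
      ext
      omega
  | @child T T' hT hchild ih =>
    obtain ⟨hle, hinj⟩ := ih
    have hb := S.vgen_bsv T hT
    rcases hchild with rfl | rfl
    · refine ⟨fun i => ?_, fun i j hij => ?_⟩
      · have hgen : T.child1.gen = T.gen + 1 := rfl
        have := hle i
        rcases T.child1_vertex_cases i with ⟨-, h⟩ | ⟨-, h⟩ <;> rw [h] <;> omega
      · have hi := hle i
        have hj := hle j
        rcases T.child1_vertex_cases i with ⟨hik, h⟩ | ⟨-, h⟩ <;>
          rcases T.child1_vertex_cases j with ⟨hjk, h'⟩ | ⟨-, h'⟩ <;>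
          simp only [h, h'] at hij
        · exact Fin.ext (hik.trans hjk.symm)
        · omega
        · omega
        · exact hinj hij
    · refine ⟨fun i => ?_, fun i j hij => ?_⟩
      · have hgen : T.child2.gen = T.gen + 1 := rfl
        rcases T.child2_vertex_cases i with ⟨-, h⟩ | ⟨l, h, -⟩
        · rw [h]; omega
        · have := hle l
          rw [h]; omega
      · rcases T.child2_vertex_cases i with ⟨hik, h⟩ | ⟨l, h, hl⟩ <;>
          rcases T.child2_vertex_cases j with ⟨hjk, h'⟩ | ⟨m, h', hm⟩ <;>
          simp only [h, h'] at hij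
        · exact Fin.ext (hik.trans hjk.symm)
        · have := hle m
          omega
        · have := hle l
          omega
        · have hlm : l = m := hinj hij
          subst hlm
          ext
          omega

end ColoredSetup

theorem vertex_on_bisection_edge_of_child (d : ℕ) (hd : 2 ≤ d) (S : ColoredSetup d)
    (T T₁ : Simplex d) (hT : MemM S.T0 T) (hchild : T₁.IsChild T)
    (v : Pt d) (hv : v ∈ T.V ∩ T₁.V) (hbse : v ∈ T.bse) :
    v ∈ T₁.bse := by
  have hd0 : 0 < d := by omega
  obtain ⟨hle, hinj⟩ := S.vgen_vertex_le_and_injective hT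
  have hb := S.vgen_bsv T hT
  have hne : ∀ j, T.vertex j ≠ T.bsv := fun j h => by
    have := hle j
    rw [h, hb] at this
    omega
  have hvert : ∀ {i j : Fin (d + 1)}, T.vertex i = T.vertex j → (i : ℕ) = j := fun h =>
    congrArg Fin.val (hinj (congrArg S.vgen h))
  have hk1 := T.one_le_k hd0
  have hkd := T.k_le
  have hkval : (T.kIdx : ℕ) = T.k := rfl
  have hk' : (T₁.kIdx : ℕ) = if T.k = 1 then d else T.k - 1 :=
    Simplex.k_eq_of_gen_eq_succ hd0 (by rcases hchild with rfl | rfl <;> rfl)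
  obtain ⟨-, i, hi⟩ := hv
  simp only [Simplex.bse, Sym2.mem_iff] at hbse ⊢
  rcases hchild with rfl | rfl
  · left
    rw [T.child1_vertex_of_ne (by simp; omega)]
    rcases hbse with h | h
    · exact h
    · rcases T.child1_vertex_cases i with ⟨-, hc⟩ | ⟨hik, hc⟩
      · exact absurd (h.symm.trans (hi.symm.trans hc)) (hne _)
      · exact absurd (hvert (hc.symm.trans (hi.trans h))) hik
  · rcases hbse with h | h
    · rcases T.child2_vertex_cases i with ⟨-, hc⟩ | ⟨j, hc, hj⟩
      · exact absurd (h.symm.trans (hi.symm.trans hc)) (hne _)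
      · have := hvert (hc.symm.trans (hi.trans h))
        simp only [Fin.val_zero] at this
        omega
    · by_cases hk : T.k = 1
      · left
        rw [T.child2_vertex_of_lt (by simp; omega), h]
        congr 1
        ext
        simp [hkval, hk]
      · right
        rw [if_neg hk] at hk'
        rw [T.child2_vertex_of_lt (by omega), h]
        congr 1
        ext
        simp only [hkval]
        omega

end BisecGrading
end
end

section
/- Let 𝒯_0 be a colored initial triangulation. Then any d-simplex T ∈ 𝕄 has exactly d − type(T) + 1 edges of type one, and the level of each of these edges coincides with level(T). -/
noncomputable section

namespace BisecGrading

variable {d : ℕ}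

/-- The vertex generations `f` of a simplex of generation `d * q + r` with `1 ≤ r ≤ d`: the
positions after `d - r` carry the vertices created since generation `d * q`, the positions up to
`d - r` carry a window, shifted by `a`, of the vertices of the ancestor of generation `d * q`. -/
structure IsLayered (d : ℕ) (q : ℤ) (r a : ℕ) (f : Fin (d + 1) → ℤ) : Prop where
  one_le : 1 ≤ r
  le_dim : r ≤ d
  shift_le : a ≤ r
  new : ∀ i : Fin (d + 1), d < i + r → f i = d * q + d - i + 1
  old : ∀ i : Fin (d + 1), 1 ≤ (i : ℕ) → i + r ≤ d → f i = d * q + 1 - (i + a)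
  zero_le : f 0 ≤ d * q
  zero : r < d → (a = 0 ∧ f 0 ≤ d * q - d) ∨ (1 ≤ a ∧ f 0 = d * q + 1 - a)

lemma lvlZ_mul_add (d : ℕ) (q s : ℤ) (h1 : 1 ≤ s) (h2 : s ≤ d) : lvlZ d (d * q + s) = q + 1 := by
  have hd : (0 : ℤ) < d := by omega
  have h : (d : ℤ) * q + s + d - 1 = (s - 1) + d * (q + 1) := by ring
  rw [lvlZ, h, Int.add_mul_ediv_left _ _ hd.ne', Int.ediv_eq_zero_of_lt (by omega) (by omega),
    zero_add]

lemma typZ_mul_add (d : ℕ) (q s : ℤ) (h1 : 1 ≤ s) (h2 : s ≤ d) : typZ d (d * q + s) = s := by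
  rw [typZ, lvlZ_mul_add d q s h1 h2]
  ring

namespace IsLayered

variable {d : ℕ} {q : ℤ} {r a : ℕ} {f : Fin (d + 1) → ℤ}

lemma update_of_lt (h : IsLayered d q r a f) (hr : r < d) {g : Fin (d + 1) → ℤ}
    (hlt : ∀ i : Fin (d + 1), i + r < d → g i = f i)
    (heq : ∀ i : Fin (d + 1), i + r = d → g i = d * q + r + 1)
    (hgt : ∀ i : Fin (d + 1), d < i + r → g i = f i) :
    IsLayered d q (r + 1) a g := by
  obtain ⟨h1, h2, h3, hnew, hold, hz, hz'⟩ := h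
  have g0 : g 0 = f 0 := hlt 0 (by simpa using hr)
  refine ⟨by omega, by omega, by omega, fun i hi => ?_, fun i hi hi' => ?_, by omega,
    fun _ => by rw [g0]; exact hz' hr⟩
  · rcases Nat.lt_or_ge d (i + r) with hi' | hi'
    · rw [hgt i hi', hnew i hi']
    · rw [heq i (by omega)]; omega
  · rw [hlt i (by omega), hold i hi (by omega)]

lemma shift_of_lt (h : IsLayered d q r a f) (hr : r < d) {g : Fin (d + 1) → ℤ}
    (hlt : ∀ i j : Fin (d + 1), i + r < d → (j : ℕ) = i + 1 → g i = f j)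
    (heq : ∀ i : Fin (d + 1), i + r = d → g i = d * q + r + 1)
    (hgt : ∀ i : Fin (d + 1), d < i + r → g i = f i) :
    IsLayered d q (r + 1) (a + 1) g := by
  obtain ⟨h1, h2, h3, hnew, hold, hz, hz'⟩ := h
  have hold' : ∀ i : Fin (d + 1), i + r < d → g i = d * q - (i + a) := fun i hi => by
    rw [hlt i ⟨i + 1, by omega⟩ hi rfl, hold _ (by simp) (by simp; omega)]
    push_cast
    ring
  have g0 : g 0 = d * q - a := by simpa using hold' 0 (by simpa using hr)
  refine ⟨by omega, by omega, by omega, fun i hi => ?_, fun i hi hi' => ?_, by omega,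
    fun _ => Or.inr ⟨by omega, by rw [g0]; push_cast; ring⟩⟩
  · rcases Nat.lt_or_ge d (i + r) with hi' | hi'
    · rw [hgt i hi', hnew i hi']
    · rw [heq i (by omega)]; omega
  · rw [hold' i (by omega)]; push_cast; ring

lemma update_of_eq (h : IsLayered d q d a f) {g : Fin (d + 1) → ℤ}
    (hlt : ∀ i : Fin (d + 1), (i : ℕ) < d → g i = f i)
    (heq : ∀ i : Fin (d + 1), (i : ℕ) = d → g i = d * q + d + 1) :
    IsLayered d (q + 1) 1 0 g := by
  obtain ⟨h1, h2, h3, hnew, hold, hz, hz'⟩ := h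
  have g0 : g 0 = f 0 := hlt 0 (by simp; omega)
  have hm : (d : ℤ) * (q + 1) = d * q + d := by ring
  refine ⟨by omega, by omega, by omega, fun i hi => ?_, fun i hi hi' => ?_, by omega,
    fun _ => Or.inl ⟨rfl, by omega⟩⟩
  · rw [heq i (by omega)]; omega
  · rw [hlt i (by omega), hnew i (by omega)]; omega

lemma shift_of_eq (h : IsLayered d q d a f) {g : Fin (d + 1) → ℤ}
    (hlt : ∀ i j : Fin (d + 1), (i : ℕ) < d → (j : ℕ) = i + 1 → g i = f j)
    (heq : ∀ i : Fin (d + 1), (i : ℕ) = d → g i = d * q + d + 1) :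
    IsLayered d (q + 1) 1 1 g := by
  obtain ⟨h1, h2, h3, hnew, hold, hz, hz'⟩ := h
  have hm : (d : ℤ) * (q + 1) = d * q + d := by ring
  have hold' : ∀ i : Fin (d + 1), (i : ℕ) < d → g i = d * q + d - i := fun i hi => by
    rw [hlt i ⟨i + 1, by omega⟩ hi rfl, hnew _ (by simp)]
    push_cast
    ring
  have g0 : g 0 = d * q + d := by simpa using hold' 0 (by simp; omega)
  refine ⟨by omega, by omega, by omega, fun i hi => ?_, fun i hi hi' => ?_, by omega,
    fun _ => Or.inr ⟨le_rfl, by omega⟩⟩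
  · rw [heq i (by omega)]; omega
  · rw [hold' i (by omega)]; omega

lemma last (h : IsLayered d q r a f) : f (Fin.last d) = d * q + 1 := by
  rw [h.new _ (by have := h.one_le; simp; omega)]
  simp

lemma le_of_add_le (h : IsLayered d q r a f) {i : Fin (d + 1)} (hi : i + r ≤ d) :
    f i ≤ d * q := by
  rcases Nat.eq_zero_or_pos (i : ℕ) with h0 | h0
  · rw [show i = 0 from Fin.ext h0]; exact h.zero_le
  · rw [h.old i h0 hi]; omega

lemma ne_of_lt (h : IsLayered d q r a f) {i j : Fin (d + 1)} (hij : i < j) : f i ≠ f j := by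
  have hle := @le_of_add_le _ _ _ _ _ h
  obtain ⟨h1, h2, h3, hnew, hold, hz, hz'⟩ := h
  have hij' : (i : ℕ) < j := hij
  rcases Nat.lt_or_ge d (j + r) with hj | hj
  · rw [hnew j hj]
    rcases Nat.lt_or_ge d (i + r) with hi | hi
    · rw [hnew i hi]; omega
    · have := hle hi; omega
  · rw [hold j (by omega) hj]
    rcases Nat.eq_zero_or_pos (i : ℕ) with h0 | h0
    · rw [show i = 0 from Fin.ext h0]
      have := hz' (by omega)
      omega
    · rw [hold i h0 (by omega)]; omega

lemma injective (h : IsLayered d q r a f) : Function.Injective f := by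
  intro i j hij
  by_contra hne
  rcases lt_or_gt_of_ne hne with hlt | hlt
  · exact h.ne_of_lt hlt hij
  · exact h.ne_of_lt hlt hij.symm

lemma max_last (h : IsLayered d q r a f) {i : Fin (d + 1)} (hi : i + r ≤ d) :
    max (f (Fin.last d)) (f i) = d * q + 1 := by
  rw [h.last, max_eq_left]
  have := h.le_of_add_le hi
  omega

lemma eq_last_of_typZ_max (h : IsLayered d q r a f) {i j : Fin (d + 1)} (hij : i < j)
    (ht : typZ d (max (f i) (f j)) = 1) : j = Fin.last d ∧ i + r ≤ d := by
  have hle := @le_of_add_le _ _ _ _ _ h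
  obtain ⟨h1, h2, h3, hnew, hold, hz, hz'⟩ := h
  have hij' : (i : ℕ) < j := hij
  have key : ∀ s : ℤ, 1 ≤ s → s ≤ d → max (f i) (f j) = d * q + s → s = 1 := by
    intro s hs hs' he
    rwa [he, typZ_mul_add d q s hs hs'] at ht
  have key' : ∀ s : ℤ, 1 ≤ s → s ≤ d → max (f i) (f j) = d * q - d + s → s = 1 := by
    intro s hs hs' he
    rwa [he, show (d : ℤ) * q - d + s = d * (q - 1) + s by ring,
      typZ_mul_add d (q - 1) s hs hs'] at ht
  rcases Nat.lt_or_ge d (j + r) with hj | hj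
  · have fj := hnew j hj
    rcases Nat.lt_or_ge d (i + r) with hi | hi
    · have fi := hnew i hi
      have := key (d - i + 1) (by omega) (by
        rcases Nat.eq_zero_or_pos (i : ℕ) with h0 | h0
        · rw [show i = 0 from Fin.ext h0] at fi
          simp only [Fin.coe_ofNat_eq_mod, Nat.zero_mod] at fi
          omega
        · omega) (by omega)
      omega
    · have fi := hle hi
      have := key (d - j + 1) (by omega) (by omega) (by omega)
      exact ⟨Fin.ext (by simp; omega), hi⟩
  · exfalso
    have fj := hold j (by omega) hj
    rcases Nat.eq_zero_or_pos (i : ℕ) with h0 | h0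
    · rw [show i = 0 from Fin.ext h0] at key'
      rcases hz' (by omega) with ⟨ha, h0'⟩ | ⟨ha, h0'⟩
      · have := key' (d + 1 - j) (by omega) (by omega) (by omega)
        omega
      · have := key' (d + 1 - a) (by omega) (by omega) (by omega)
        omega
    · have fi := hold i h0 (by omega)
      have := key' (d + 1 - (i + a)) (by omega) (by omega) (by omega)
      omega

end IsLayered

namespace Simplex

lemma add_k_of_lt {d : ℕ} {T : Simplex d} {q : ℤ} {r : ℕ} (hg : (T.gen : ℤ) = d * q + r)
    (hr : r < d) : T.k + r = d := by
  have h : ((T.gen % d : ℕ) : ℤ) = r := by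
    rw [Int.natCast_mod, hg, Int.mul_add_emod_self_left, Int.emod_eq_of_lt] <;> omega
  have : T.k = d - T.gen % d := rfl
  omega

lemma k_of_eq {d : ℕ} {T : Simplex d} {q : ℤ} (hg : (T.gen : ℤ) = d * q + d) : T.k = d := by
  have h : ((T.gen % d : ℕ) : ℤ) = 0 := by
    rw [Int.natCast_mod, hg]; simp
  have : T.k = d - T.gen % d := rfl
  omega

variable {d : ℕ} (T : Simplex d) (i : Fin (d + 1))

lemma child1_vertex_of_ne_s8 (h : (i : ℕ) ≠ T.k) : T.child1.vertex i = T.vertex i :=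
  Function.update_of_ne (fun hi => h (congrArg Fin.val hi)) _ _

lemma child1_vertex_of_eq (h : (i : ℕ) = T.k) : T.child1.vertex i = T.bsv := by
  rw [show i = T.kIdx from Fin.ext h]
  exact Function.update_self _ _ _

lemma child2_vertex_of_lt_s8 {j : Fin (d + 1)} (h : (i : ℕ) < T.k) (hj : (j : ℕ) = i + 1) :
    T.child2.vertex i = T.vertex j := by
  simp only [child2, h, dif_pos]
  exact congrArg T.vertex (Fin.ext hj.symm)

lemma child2_vertex_of_eq_s8 (h : (i : ℕ) = T.k) : T.child2.vertex i = T.bsv := by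
  simp [child2, h]

lemma child2_vertex_of_gt_s8 (h : T.k < i) : T.child2.vertex i = T.vertex i := by
  simp [child2, h.not_gt, h.ne']

end Simplex

lemma ColoredSetup.exists_isLayered {d : ℕ} (hd : 1 ≤ d) (S : ColoredSetup d) {T : Simplex d}
    (hT : MemM S.T0 T) :
    ∃ (q : ℤ) (r a : ℕ), (T.gen : ℤ) = d * q + r ∧
      IsLayered d q r a fun i => S.vgen (T.vertex i) := by
  induction hT with
  | init h =>
    rename_i T
    have h0 : S.vgen (T.vertex 0) = -d := by rw [S.vgen_init T h, S.color_zero T h]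
    refine ⟨-1, d, 0, by simp [S.gen_zero T h], hd, le_rfl, Nat.zero_le _, fun i hi => ?_,
      fun i hi hi' => by omega, by simp [h0], fun hlt => absurd hlt (lt_irrefl _)⟩
    have := S.color_succ T h i (by omega)
    simp only [S.vgen_init T h, this]
    omega
  | @child T T' hT hc ih =>
    obtain ⟨q, r, a, hg, hL⟩ := ih
    have hb := S.vgen_bsv T hT
    rcases hL.le_dim.lt_or_eq with hr | rfl
    · have hk := Simplex.add_k_of_lt hg hr
      rcases hc with rfl | rfl
      · refine ⟨q, r + 1, a, by simp [Simplex.child1, hg, add_assoc], hL.update_of_lt hr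
          (fun i hi => ?_) (fun i hi => ?_) (fun i hi => ?_)⟩
        · rw [T.child1_vertex_of_ne_s8 i (by omega)]
        · rw [T.child1_vertex_of_eq i (by omega), hb, hg]
        · rw [T.child1_vertex_of_ne_s8 i (by omega)]
      · refine ⟨q, r + 1, a + 1, by simp [Simplex.child2, hg, add_assoc], hL.shift_of_lt hr
          (fun i j hi hj => ?_) (fun i hi => ?_) (fun i hi => ?_)⟩
        · rw [T.child2_vertex_of_lt_s8 i (by omega) hj]
        · rw [T.child2_vertex_of_eq_s8 i (by omega), hb, hg]
        · rw [T.child2_vertex_of_gt_s8 i (by omega)]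
    · have hk := Simplex.k_of_eq hg
      rcases hc with rfl | rfl
      · refine ⟨q + 1, 1, 0, by simp [Simplex.child1, hg, mul_add], hL.update_of_eq
          (fun i hi => ?_) (fun i hi => ?_)⟩
        · rw [T.child1_vertex_of_ne_s8 i (by omega)]
        · rw [T.child1_vertex_of_eq i (by omega), hb, hg]
      · refine ⟨q + 1, 1, 1, by simp [Simplex.child2, hg, mul_add], hL.shift_of_eq
          (fun i j hi hj => ?_) (fun i hi => ?_)⟩
        · rw [T.child2_vertex_of_lt_s8 i (by omega) hj]
        · rw [T.child2_vertex_of_eq_s8 i (by omega), hb, hg]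

lemma ColoredSetup.typeOneEdges_eq {d : ℕ} (S : ColoredSetup d) {T : Simplex d} {q : ℤ}
    {r a : ℕ} (hL : IsLayered d q r a fun i => S.vgen (T.vertex i)) :
    {e | e ∈ T.E ∧ S.typE e = 1} =
      (fun i => s(T.vertex (Fin.last d), T.vertex i)) '' {i : Fin (d + 1) | i + r ≤ d} := by
  have h1 := hL.one_le
  have h2 := hL.le_dim
  ext e
  constructor
  · rintro ⟨⟨i, j, hij, rfl⟩, ht⟩
    rcases lt_or_gt_of_ne hij with hlt | hlt
    · obtain ⟨rfl, hi⟩ := hL.eq_last_of_typZ_max hlt ht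
      exact ⟨i, hi, Sym2.eq_swap⟩
    · rw [Sym2.eq_swap] at ht
      obtain ⟨rfl, hi⟩ := hL.eq_last_of_typZ_max hlt ht
      exact ⟨j, hi, rfl⟩
  · rintro ⟨i, hi, rfl⟩
    have hi' : (i : ℕ) + r ≤ d := hi
    refine ⟨⟨Fin.last d, i, fun h => ?_, rfl⟩, ?_⟩
    · rw [← h, Fin.val_last] at hi'
      omega
    · change typZ d (max _ _) = 1
      rw [hL.max_last hi']
      exact typZ_mul_add d q 1 le_rfl (by omega)

theorem type_one_edges (d : ℕ) (hd : 2 ≤ d) (S : ColoredSetup d)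
    (T : Simplex d) (hT : MemM S.T0 T) :
    ({e | e ∈ T.E ∧ S.typE e = 1}.ncard : ℤ) = d - T.typ + 1 ∧
    ∀ e ∈ T.E, S.typE e = 1 → S.lvlE e = T.lvl := by
  obtain ⟨q, r, a, hg, hL⟩ := S.exists_isLayered (by omega) hT
  have h1 := hL.one_le
  have h2 := hL.le_dim
  have hset := S.typeOneEdges_eq hL
  constructor
  · have hinj : Function.Injective fun i => s(T.vertex (Fin.last d), T.vertex i) := fun i j hij =>
      hL.injective (congrArg S.vgen (Sym2.congr_right.1 hij))
    have hIic : {i : Fin (d + 1) | i + r ≤ d} =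
        (Finset.Iic (⟨d - r, by omega⟩ : Fin (d + 1)) : Set (Fin (d + 1))) := by
      ext i
      simp only [Set.mem_ofPred_eq, Finset.coe_Iic, Set.mem_Iic, Fin.le_def]
      omega
    rw [hset, Set.ncard_image_of_injective _ hinj, hIic, Set.ncard_coe_finset, Fin.card_Iic,
      Simplex.typ, hg, typZ_mul_add d q r (by omega) (by omega)]
    push_cast [h2]
    ring
  · intro e he ht
    obtain ⟨i, hi, rfl⟩ := hset.subset ⟨he, ht⟩
    change lvlZ d (max _ _) = lvlZ d T.gen
    rw [hL.max_last hi, hg, lvlZ_mul_add d q 1 le_rfl (by omega),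
      lvlZ_mul_add d q r (by omega) (by omega)]

end BisecGrading
end
end
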